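/- arXiv:2603.22129 — 3 statements merged into one kernel-verified Lean document; each statement's English description precedes it below -/
import Mathlib

section
/- Corollary (NGN inequality for general Q-stable matrix free polynomials): Let P ∈ M_k(ℂ⟨Z⟩) be Q-stable and suppose P = P₁ · P₂ ⋯ P_l where each P_i ∈ M_k(ℂ⟨Z⟩) is an atom. Then each P_i is Q-stable, and there exists a finite constant C such that for every r ∈ [0,1), every n ≥ 1 and every X ∈ 𝔻_Q(n) one has ‖P₁(rX)⁻¹ P₁(X) · P₂(rX)⁻¹ P₂(X) ⋯ P_l(rX)⁻¹ P_l(X)‖ ≤ C and ‖P₁(X) P₁(rX)⁻¹ · P₂(X) P₂(rX)⁻¹ ⋯ P_l(X) P_l(rX)⁻¹‖ ≤ C. -/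
open scoped Kronecker ENNReal

noncomputable section

/-- The operator norm of a square complex matrix acting on Euclidean (ℓ²) space. -/
def opNorm {m : Type*} [Fintype m] [DecidableEq m] (M : Matrix m m ℂ) : ℝ :=
  ‖Matrix.toEuclideanCLM (𝕜 := ℂ) M‖

/-- Evaluation of a free polynomial in `ℂ⟨Z₁,…,Z_d⟩` at a `d`-tuple of `n×n`
complex matrices, i.e. the unital algebra homomorphism sending `Z_j` to `X_j`. -/
def ncEval {d n : ℕ} (X : Fin d → Matrix (Fin n) (Fin n) ℂ) :
    FreeAlgebra ℂ (Fin d) →ₐ[ℂ] Matrix (Fin n) (Fin n) ℂ :=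
  FreeAlgebra.lift ℂ X

/-- Entrywise evaluation of a `k×k` matrix of free polynomials at a `d`-tuple of
`n×n` matrices, flattened to a `kn × kn` complex matrix. -/
def ncEvalM {d k n : ℕ} (P : Matrix (Fin k) (Fin k) (FreeAlgebra ℂ (Fin d)))
    (X : Fin d → Matrix (Fin n) (Fin n) ℂ) :
    Matrix (Fin k × Fin n) (Fin k × Fin n) ℂ :=
  Matrix.of fun p q => ncEval X (P p.1 q.1) p.2 q.2

/-- Membership of `X` in the NC operator ball `𝔻_Q(n)`: `‖∑_j Q_j ⊗ X_j‖ < 1`. -/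
def memBallQ {d l n : ℕ} (Q : Fin d → Matrix (Fin l) (Fin l) ℂ)
    (X : Fin d → Matrix (Fin n) (Fin n) ℂ) : Prop :=
  opNorm (∑ j, Q j ⊗ₖ X j) < 1

/-- The supremum norm `‖G‖_Q ∈ [0,∞]` of a matrix free polynomial over `𝔻_Q`. -/
def normQ {d k l : ℕ} (Q : Fin d → Matrix (Fin l) (Fin l) ℂ)
    (G : Matrix (Fin k) (Fin k) (FreeAlgebra ℂ (Fin d))) : ℝ≥0∞ :=
  ⨆ (n : ℕ) (X : Fin d → Matrix (Fin (n + 1)) (Fin (n + 1)) ℂ) (_ : memBallQ Q X),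
    ENNReal.ofReal (opNorm (ncEvalM G X))

/-- The supremum norm `‖p‖_Q ∈ [0,∞]` of a scalar free polynomial over `𝔻_Q`. -/
def normQ1 {d l : ℕ} (Q : Fin d → Matrix (Fin l) (Fin l) ℂ)
    (p : FreeAlgebra ℂ (Fin d)) : ℝ≥0∞ :=
  ⨆ (n : ℕ) (X : Fin d → Matrix (Fin (n + 1)) (Fin (n + 1)) ℂ) (_ : memBallQ Q X),
    ENNReal.ofReal (opNorm (ncEval X p))

/-- `P ∈ M_k(ℂ⟨Z⟩)` is `Q`-stable if `P(X)` is invertible at every point of `𝔻_Q`. -/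
def QStable {d k l : ℕ} (Q : Fin d → Matrix (Fin l) (Fin l) ℂ)
    (P : Matrix (Fin k) (Fin k) (FreeAlgebra ℂ (Fin d))) : Prop :=
  ∀ (n : ℕ) (X : Fin d → Matrix (Fin (n + 1)) (Fin (n + 1)) ℂ),
    memBallQ Q X → IsUnit (ncEvalM P X)

/-- `P` is an atom of `M_k(ℂ⟨Z⟩)`: not invertible, and in any factorization
`P = F·G` one of the two factors is invertible. -/
def IsAtomPoly {d k : ℕ} (P : Matrix (Fin k) (Fin k) (FreeAlgebra ℂ (Fin d))) : Prop :=
  ¬ IsUnit P ∧ ∀ F G : Matrix (Fin k) (Fin k) (FreeAlgebra ℂ (Fin d)),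
    P = F * G → IsUnit F ∨ IsUnit G

/-- A free polynomial is homogeneous of degree `j` if rescaling the generators
by a scalar `t` rescales it by `t^j`. -/
def HomogeneousDeg {d : ℕ} (j : ℕ) (p : FreeAlgebra ℂ (Fin d)) : Prop :=
  ∀ t : ℂ, FreeAlgebra.lift ℂ (fun i => t • FreeAlgebra.ι ℂ i) p = t ^ j • p

end

namespace NGN

section Ball

variable {d l : ℕ} {E : Type} [NormedAddCommGroup E] [InnerProductSpace ℂ E]

/-- Coordinate-free description of the operator ball: `∑ j, Q j ⊗ x j` is a strict contraction
on the `l`-fold Hilbert sum of `E`. -/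
def Ball (Q : Fin d → Matrix (Fin l) (Fin l) ℂ) (x : Fin d → E →L[ℂ] E) : Prop :=
  ∃ c : ℝ, 0 ≤ c ∧ c < 1 ∧ ∀ z : Fin l → E,
    ∑ a, ‖∑ j, ∑ b, Q j a b • x j (z b)‖ ^ 2 ≤ c ^ 2 * ∑ b, ‖z b‖ ^ 2

variable {Q : Fin d → Matrix (Fin l) (Fin l) ℂ}

theorem Ball.of_contraction {x y : Fin d → E →L[ℂ] E} (hx : Ball Q x)
    (h : ∀ z : Fin l → E, ∀ a,
      ‖∑ j, ∑ b, Q j a b • y j (z b)‖ ≤ ‖∑ j, ∑ b, Q j a b • x j (z b)‖) : Ball Q y := by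
  obtain ⟨c, hc0, hc1, hc⟩ := hx
  refine ⟨c, hc0, hc1, fun z => le_trans (Finset.sum_le_sum fun a _ => ?_) (hc z)⟩
  exact pow_le_pow_left₀ (norm_nonneg _) (h z a) 2

theorem Ball.smul {x : Fin d → E →L[ℂ] E} (hx : Ball Q x) {t : ℂ} (ht : ‖t‖ ≤ 1) :
    Ball Q (fun j => t • x j) := by
  refine hx.of_contraction fun z a => ?_
  have : ∑ j, ∑ b, Q j a b • (t • x j) (z b) = t • ∑ j, ∑ b, Q j a b • x j (z b) := by
    simp only [Finset.smul_sum, smul_apply, smul_comm t]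
  rw [this, norm_smul]
  exact mul_le_of_le_one_left (norm_nonneg _) ht

/-- Following a point of the ball by the rank one operator `v ⟨u, ·⟩` stays in the ball. -/
theorem Ball.rankOne {x : Fin d → E →L[ℂ] E} (hx : Ball Q x) {u v : E} (hu : ‖u‖ ≤ 1)
    (hv : ‖v‖ ≤ 1) : Ball Q (fun j => ((innerSL ℂ u).comp (x j)).smulRight v) := by
  refine hx.of_contraction fun z a => ?_
  have : ∑ j, ∑ b, Q j a b • (((innerSL ℂ u).comp (x j)).smulRight v) (z b) =
      (innerSL ℂ u) (∑ j, ∑ b, Q j a b • x j (z b)) • v := by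
    simp only [map_sum, map_smul, Finset.sum_smul, ContinuousLinearMap.smulRight_apply,
      ContinuousLinearMap.comp_apply, smul_eq_mul, mul_smul]
  rw [this, norm_smul]
  have h1 : ‖(innerSL ℂ u) (∑ j, ∑ b, Q j a b • x j (z b))‖ ≤
      1 * ‖∑ j, ∑ b, Q j a b • x j (z b)‖ :=
    (norm_inner_le_norm _ _).trans (mul_le_mul_of_nonneg_right hu (norm_nonneg _))
  calc _ ≤ ‖(innerSL ℂ u) (∑ j, ∑ b, Q j a b • x j (z b))‖ * 1 :=
        mul_le_mul_of_nonneg_left hv (norm_nonneg _)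
    _ ≤ _ := by simpa using h1

theorem sum_norm_mulVec_sq_le {m : Type*} [Fintype m] [DecidableEq m] (M : Matrix m m ℂ)
    (x : m → ℂ) : ∑ i, ‖(M.mulVec x) i‖ ^ 2 ≤ opNorm M ^ 2 * ∑ i, ‖x i‖ ^ 2 := by
  have h := (Matrix.toEuclideanCLM (𝕜 := ℂ) M).le_opNorm (WithLp.toLp 2 x)
  have h2 := pow_le_pow_left₀ (norm_nonneg _) h 2
  rw [mul_pow, EuclideanSpace.norm_sq_eq, EuclideanSpace.norm_sq_eq] at h2
  exact h2

theorem opNorm_le_of_sum_norm_mulVec_sq_le {m : Type*} [Fintype m] [DecidableEq m]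
    (M : Matrix m m ℂ) {c : ℝ} (hc : 0 ≤ c)
    (h : ∀ x : m → ℂ, ∑ i, ‖(M.mulVec x) i‖ ^ 2 ≤ c ^ 2 * ∑ i, ‖x i‖ ^ 2) : opNorm M ≤ c := by
  refine ContinuousLinearMap.opNorm_le_bound _ hc fun x => ?_
  refine le_of_sq_le_sq ?_ (by positivity)
  rw [mul_pow, EuclideanSpace.norm_sq_eq, EuclideanSpace.norm_sq_eq]
  exact h x.ofLp

/-- Small multiples of a single rank one operator in one coordinate lie in the ball. -/
theorem exists_ball_single (Q : Fin d → Matrix (Fin l) (Fin l) ℂ) :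
    ∃ ε : ℝ, 0 < ε ∧ ∀ (E : Type) [NormedAddCommGroup E] [InnerProductSpace ℂ E] (v : E),
      ‖v‖ ≤ 1 → ∀ i : Fin d,
        Ball Q (fun j => if j = i then (ε : ℂ) • (innerSL ℂ v).smulRight v else 0) := by
  set S : ℝ := ∑ j, opNorm (Q j) with hS
  have hQ0 : ∀ j, 0 ≤ opNorm (Q j) := fun j => norm_nonneg _
  have hS0 : 0 ≤ S := Finset.sum_nonneg fun j _ => hQ0 j
  refine ⟨1 / (2 * (1 + S)), by positivity, fun E _ _ v hv i => ⟨1 / 2, by norm_num, by norm_num,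
    fun z => ?_⟩⟩
  set ε : ℝ := 1 / (2 * (1 + S)) with hε
  have hε0 : 0 < ε := by positivity
  have key : ∀ a, ∑ j, ∑ b, Q j a b •
      (if j = i then (ε : ℂ) • (innerSL ℂ v).smulRight v else (0 : E →L[ℂ] E)) (z b) =
      ((ε : ℂ) * ((Q i).mulVec fun b => inner ℂ v (z b)) a) • v := by
    intro a
    rw [Finset.sum_eq_single i]
    · simp only [if_true, Matrix.mulVec, dotProduct, Finset.mul_sum, Finset.sum_smul,
        smul_apply, ContinuousLinearMap.smulRight_apply, innerSL_apply_apply,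
        smul_smul]
      exact Finset.sum_congr rfl fun b _ => by congr 1; ring
    · intro j _ hj; simp [hj]
    · simp
  have hb : opNorm (Q i) * ε ≤ 1 / 2 := by
    have : opNorm (Q i) ≤ 1 + S := by
      have := Finset.single_le_sum (fun j _ => hQ0 j) (Finset.mem_univ i)
      linarith
    rw [hε, mul_one_div, div_le_div_iff₀ (by positivity) (by norm_num)]
    linarith
  calc _ ≤ ∑ a, ε ^ 2 * ‖((Q i).mulVec fun b => inner ℂ v (z b)) a‖ ^ 2 := by
        refine Finset.sum_le_sum fun a _ => ?_
        rw [key, norm_smul, norm_mul, Complex.norm_real, Real.norm_of_nonneg hε0.le, mul_pow,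
          mul_pow]
        exact mul_le_of_le_one_right (by positivity) (pow_le_one₀ (norm_nonneg _) hv)
    _ ≤ ε ^ 2 * (opNorm (Q i) ^ 2 * ∑ b, ‖inner ℂ v (z b)‖ ^ 2) := by
        rw [← Finset.mul_sum]
        exact mul_le_mul_of_nonneg_left (sum_norm_mulVec_sq_le _ _) (by positivity)
    _ = (opNorm (Q i) * ε) ^ 2 * ∑ b, ‖inner ℂ v (z b)‖ ^ 2 := by ring
    _ ≤ (1 / 2) ^ 2 * ∑ b, ‖z b‖ ^ 2 := by
        refine mul_le_mul (pow_le_pow_left₀ (mul_nonneg (hQ0 i) hε0.le) hb 2)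
          (Finset.sum_le_sum fun b _ => pow_le_pow_left₀ (norm_nonneg _) ?_ 2)
          (Finset.sum_nonneg fun _ _ => by positivity) (by positivity)
        exact (norm_inner_le_norm _ _).trans (mul_le_of_le_one_left (norm_nonneg _) hv)

/-- The block weighted cyclic shift with weights `x i`. -/
def cyclicShift {m : ℕ} (x : Fin (m + 1) → E →L[ℂ] E) :
    PiLp 2 (fun _ : Fin (m + 1) => E) →L[ℂ] PiLp 2 (fun _ : Fin (m + 1) => E) :=
  (PiLp.continuousLinearEquiv 2 ℂ (fun _ : Fin (m + 1) => E)).symm.toContinuousLinearMap.comp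
    (ContinuousLinearMap.pi fun i => (x i).comp (PiLp.proj 2 (fun _ : Fin (m + 1) => E) (i + 1)))

@[simp]
theorem cyclicShift_apply {m : ℕ} (x : Fin (m + 1) → E →L[ℂ] E)
    (z : PiLp 2 (fun _ : Fin (m + 1) => E)) (i : Fin (m + 1)) :
    cyclicShift x z i = x i (z (i + 1)) := rfl

theorem Ball.cyclicShift {m : ℕ} {x : Fin (m + 1) → Fin d → E →L[ℂ] E}
    (hx : ∀ i, Ball Q (x i)) : Ball Q (fun j => cyclicShift fun i => x i j) := by
  choose c hc0 hc1 hc using hx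
  obtain ⟨i₀, -, hi₀⟩ := Finset.exists_max_image Finset.univ c Finset.univ_nonempty
  refine ⟨c i₀, hc0 i₀, hc1 i₀, fun z => ?_⟩
  simp only [PiLp.norm_sq_eq_of_L2, WithLp.ofLp_sum, WithLp.ofLp_smul, Finset.sum_apply, Pi.smul_apply,
    cyclicShift_apply]
  rw [Finset.sum_comm]
  calc _ ≤ ∑ i, c i₀ ^ 2 * ∑ b, ‖z b (i + 1)‖ ^ 2 := by
        refine Finset.sum_le_sum fun i _ => (hc i fun b => z b (i + 1)).trans ?_
        exact mul_le_mul_of_nonneg_right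
          (pow_le_pow_left₀ (hc0 i) (hi₀ i (Finset.mem_univ _)) 2)
          (Finset.sum_nonneg fun _ _ => by positivity)
    _ = c i₀ ^ 2 * ∑ b, ∑ i, ‖z b (i + 1)‖ ^ 2 := by rw [← Finset.mul_sum, Finset.sum_comm]
    _ = _ := by
        congr 1
        refine Finset.sum_congr rfl fun b _ => ?_
        exact Equiv.sum_comp (Equiv.addRight (1 : Fin (m + 1))) fun i => ‖z b i‖ ^ 2

theorem Ball.norm_le (hQ : LinearIndependent ℂ Q) :
    ∃ K : ℝ, 0 ≤ K ∧ ∀ (E : Type) [NormedAddCommGroup E] [InnerProductSpace ℂ E]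
      (x : Fin d → E →L[ℂ] E), Ball Q x → ∀ j v, ‖x j v‖ ≤ K * ‖v‖ := by
  classical
  have hdual : ∀ j, ∃ φ : Matrix (Fin l) (Fin l) ℂ →ₗ[ℂ] ℂ, ∀ i, φ (Q i) = if i = j then 1 else 0 := by
    intro j
    obtain ⟨φ, hφ⟩ := LinearMap.exists_leftInverse_of_injective
      (Finsupp.linearCombination ℂ Q) (LinearMap.ker_eq_bot.2 hQ)
    refine ⟨(Finsupp.lapply j).comp φ, fun i => ?_⟩
    have := congrArg (fun f => f (Finsupp.single i 1) j) hφ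
    simpa [Finsupp.single_apply] using this
  choose φ hφ using hdual
  set κ : Fin d → Fin l → Fin l → ℂ := fun j a b => φ j (Matrix.single a b 1) with hκ
  have hφκ : ∀ j M, φ j M = ∑ a, ∑ b, M a b * κ j a b := by
    intro j M
    conv_lhs => rw [Matrix.matrix_eq_sum_single M]
    simp only [map_sum, hκ]
    refine Finset.sum_congr rfl fun a _ => Finset.sum_congr rfl fun b _ => ?_
    rw [← smul_eq_mul, ← map_smul, Matrix.smul_single, smul_eq_mul, mul_one]
  refine ⟨∑ j, ∑ a, ∑ b, ‖κ j a b‖, by positivity, fun E _ _ x hx j v => ?_⟩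
  obtain ⟨c, hc0, hc1, hc⟩ := hx
  have hblock : ∀ a b, ‖∑ i, Q i a b • x i v‖ ≤ ‖v‖ := by
    intro a b
    have h1 := hc (Pi.single b v)
    have h2 : ∑ b', ‖(Pi.single b v : Fin l → E) b'‖ ^ 2 = ‖v‖ ^ 2 := by
      rw [Finset.sum_eq_single b] <;> simp +contextual
    rw [h2] at h1
    have h3 := (Finset.single_le_sum (f := fun a => ‖∑ j, ∑ b', Q j a b' •
      x j ((Pi.single b v : Fin l → E) b')‖ ^ 2) (fun _ _ => by positivity)
      (Finset.mem_univ a)).trans h1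
    have h4 : ∑ j, ∑ b', Q j a b' • x j ((Pi.single b v : Fin l → E) b') =
        ∑ i, Q i a b • x i v := by
      refine Finset.sum_congr rfl fun i _ => ?_
      rw [Finset.sum_eq_single b] <;> simp +contextual
    simp only [h4] at h3
    refine le_of_sq_le_sq (h3.trans ?_) (norm_nonneg _)
    exact mul_le_of_le_one_left (by positivity) (pow_le_one₀ hc0 hc1.le)
  have hxj : x j v = ∑ a, ∑ b, κ j a b • ∑ i, Q i a b • x i v := by
    have : ∑ i, φ j (Q i) • x i v = x j v := by simp [hφ]
    rw [← this]
    simp only [hφκ, Finset.sum_smul, Finset.smul_sum, smul_smul]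
    rw [Finset.sum_comm]
    refine Finset.sum_congr rfl fun a _ => ?_
    rw [Finset.sum_comm]
    exact Finset.sum_congr rfl fun b _ => Finset.sum_congr rfl fun i _ => by rw [mul_comm]
  rw [hxj]
  calc _ ≤ ∑ a, ∑ b, ‖κ j a b‖ * ‖v‖ := by
        refine (norm_sum_le _ _).trans (Finset.sum_le_sum fun a _ => (norm_sum_le _ _).trans
          (Finset.sum_le_sum fun b _ => ?_))
        rw [norm_smul]
        exact mul_le_mul_of_nonneg_left (hblock a b) (norm_nonneg _)
    _ = (∑ a, ∑ b, ‖κ j a b‖) * ‖v‖ := by simp only [Finset.sum_mul]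
    _ ≤ _ := mul_le_mul_of_nonneg_right
        (Finset.single_le_sum (f := fun j => ∑ a, ∑ b, ‖κ j a b‖) (fun _ _ => by positivity)
          (Finset.mem_univ j)) (norm_nonneg _)

theorem memBallQ_iff_ball {n : ℕ} (X : Fin d → Matrix (Fin n) (Fin n) ℂ) :
    memBallQ Q X ↔ Ball Q (fun j => Matrix.toEuclideanCLM (𝕜 := ℂ) (X j)) := by
  have key : ∀ (x : Fin l × Fin n → ℂ) (a : Fin l) (p : Fin n),
      ((∑ j, Q j ⊗ₖ X j).mulVec x) (a, p) =
        (∑ j, ∑ b, Q j a b • Matrix.toEuclideanCLM (𝕜 := ℂ) (X j)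
          (WithLp.toLp 2 fun q => x (b, q))) p := by
    intro x a p
    simp only [WithLp.ofLp_sum, WithLp.ofLp_smul, Finset.sum_apply, Pi.smul_apply,
      Matrix.ofLp_toEuclideanCLM, Matrix.mulVec, dotProduct, Matrix.sum_apply, Finset.sum_mul,
      Matrix.kroneckerMap_apply, smul_eq_mul, Fintype.sum_prod_type, Finset.mul_sum]
    rw [Finset.sum_comm (s := Finset.univ (α := Fin d))]
    refine Finset.sum_congr rfl fun b _ => ?_
    rw [Finset.sum_comm]
    exact Finset.sum_congr rfl fun j _ => Finset.sum_congr rfl fun q _ => mul_assoc _ _ _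
  have key2 : ∀ x : Fin l × Fin n → ℂ,
      ∑ i, ‖((∑ j, Q j ⊗ₖ X j).mulVec x) i‖ ^ 2 =
        ∑ a, ‖∑ j, ∑ b, Q j a b • Matrix.toEuclideanCLM (𝕜 := ℂ) (X j)
          (WithLp.toLp 2 fun q => x (b, q))‖ ^ 2 := by
    intro x
    simp only [Fintype.sum_prod_type, EuclideanSpace.norm_sq_eq, key]
  constructor
  · intro h
    refine ⟨_, norm_nonneg _, h, fun z => ?_⟩
    have := sum_norm_mulVec_sq_le (∑ j, Q j ⊗ₖ X j) fun p => z p.1 p.2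
    rw [key2] at this
    simp only [Fintype.sum_prod_type, EuclideanSpace.norm_sq_eq] at this ⊢
    exact this
  · rintro ⟨c, hc0, hc1, hc⟩
    refine lt_of_le_of_lt (opNorm_le_of_sum_norm_mulVec_sq_le _ hc0 fun x => ?_) hc1
    rw [key2]
    refine (hc _).trans (le_of_eq ?_)
    simp only [Fintype.sum_prod_type, EuclideanSpace.norm_sq_eq]

end Ball

section Pencil

variable {d l : ℕ} {V : Type} [AddCommGroup V] [Module ℂ V]
  {E : Type} [NormedAddCommGroup E] [InnerProductSpace ℂ E]

/-- The pencil `∑ j, T j ⊗ x j`, realised as an operator on `V →ₗ[ℂ] E`. -/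
def pencil (T : Fin d → Module.End ℂ V) (x : Fin d → E →L[ℂ] E) :
    Module.End ℂ (V →ₗ[ℂ] E) where
  toFun η := ∑ j, (x j : E →ₗ[ℂ] E) ∘ₗ η ∘ₗ T j
  map_add' η θ := by ext; simp [Finset.sum_add_distrib]
  map_smul' c η := by ext; simp [Finset.smul_sum]

theorem pencil_apply (T : Fin d → Module.End ℂ V) (x : Fin d → E →L[ℂ] E) (η : V →ₗ[ℂ] E)
    (h : V) : pencil T x η h = ∑ j, x j (η (T j h)) := by
  simp [pencil]

theorem pencil_smul_left (T : Fin d → Module.End ℂ V) (x : Fin d → E →L[ℂ] E) (t : ℂ)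
    (η : V →ₗ[ℂ] E) : pencil T (fun j => t • x j) η = t • pencil T x η := by
  ext h; simp [pencil_apply, Finset.smul_sum]

/-- The pencil `1 - ∑ j, T j ⊗ x j` is injective on the whole operator ball. -/
def Stable (Q : Fin d → Matrix (Fin l) (Fin l) ℂ) (T : Fin d → Module.End ℂ V) : Prop :=
  ∀ (E : Type) [NormedAddCommGroup E] [InnerProductSpace ℂ E] [FiniteDimensional ℂ E]
    (x : Fin d → E →L[ℂ] E), Ball Q x → ∀ η : V →ₗ[ℂ] E, pencil T x η = η → η = 0

/-- The resolvent of the pencil grows at most like `1 / (1 - r)` towards the boundary of the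
operator ball. -/
def ResolventBound [FiniteDimensional ℂ V] (Q : Fin d → Matrix (Fin l) (Fin l) ℂ)
    (T : Fin d → Module.End ℂ V) : Prop :=
  ∀ h : V, ∃ C : ℝ, 0 ≤ C ∧ ∀ (E : Type) [NormedAddCommGroup E] [InnerProductSpace ℂ E]
    [FiniteDimensional ℂ E] (x : Fin d → E →L[ℂ] E), Ball Q x → ∀ r : ℝ, 0 ≤ r → r < 1 →
    ∀ η y : V →ₗ[ℂ] E, η = (r : ℂ) • pencil T x η + y → ∀ M : ℝ,
      (∀ a, ‖y (Module.finBasis ℂ V a)‖ ≤ M) → ‖η h‖ ≤ C / (1 - r) * M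

variable {Q : Fin d → Matrix (Fin l) (Fin l) ℂ} {T : Fin d → Module.End ℂ V}

/-- Products of pencils over the operator ball have no eigenvalue of modulus one. -/
theorem Stable.eq_zero_of_cyclic [FiniteDimensional ℂ E] (hT : Stable Q T) {m : ℕ}
    {x : Fin (m + 1) → Fin d → E →L[ℂ] E} (hx : ∀ i, Ball Q (x i))
    {η : Fin (m + 1) → V →ₗ[ℂ] E} (hη : ∀ i, pencil T (x i) (η (i + 1)) = η i) (i : Fin (m + 1)) :
    η i = 0 := by
  let H : V →ₗ[ℂ] PiLp 2 (fun _ : Fin (m + 1) => E) :=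
    (WithLp.linearEquiv 2 ℂ (Fin (m + 1) → E)).symm.toLinearMap ∘ₗ LinearMap.pi η
  have hHapp : ∀ h i, H h i = η i h := fun h i => rfl
  have hH : H = 0 := by
    refine hT _ (fun j => cyclicShift fun i => x i j) (Ball.cyclicShift hx) H ?_
    ext h i
    rw [pencil_apply, hHapp, ← hη i, pencil_apply]
    simp only [WithLp.ofLp_sum, Finset.sum_apply, cyclicShift_apply, hHapp]
  ext h
  rw [← hHapp, hH]
  simp

theorem Stable.norm_eigenvalue_lt_one [FiniteDimensional ℂ E] (hT : Stable Q T)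
    {L : List (Fin d → E →L[ℂ] E)} (hL : ∀ x ∈ L, Ball Q x) (hL0 : L ≠ [])
    {η : V →ₗ[ℂ] E} (hη : η ≠ 0) {t : ℂ}
    (h : (L.map (pencil T)).prod η = t • η) : ‖t‖ < 1 := by
  by_contra! ht
  have ht0 : t ≠ 0 := by rintro rfl; simp at ht; linarith
  obtain ⟨x₀, L, rfl⟩ := List.exists_cons_of_ne_nil hL0
  let x : Fin (L.length + 1) → Fin d → E →L[ℂ] E :=
    Fin.cons (fun j => t⁻¹ • x₀ j) (fun i => L.get i)
  let θ : Fin (L.length + 1) → V →ₗ[ℂ] E :=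
    Fin.cons η (fun i => ((L.drop i).map (pencil T)).prod η)
  have hx : ∀ i, Ball Q (x i) := by
    refine Fin.cases ?_ fun i => ?_
    · refine (hL x₀ (by simp)).smul ?_
      rw [norm_inv]
      exact inv_le_one_of_one_le₀ ht
    · exact hL _ (List.mem_cons_of_mem _ (List.get_mem _ _))
  have hθsucc : ∀ i : Fin (L.length + 1),
      θ (i + 1) = ((L.drop i).map (pencil T)).prod η := by
    intro i
    induction i using Fin.lastCases with
    | last => simp [θ]
    | cast i => simp [θ, Fin.coeSucc_eq_succ]
  have hθ : ∀ i, pencil T (x i) (θ (i + 1)) = θ i := by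
    intro i
    rw [hθsucc]
    refine Fin.cases ?_ (fun i => ?_) i
    · simp only [x, θ, Fin.cons_zero, pencil_smul_left, Fin.val_zero, List.drop_zero]
      have : pencil T x₀ ((L.map (pencil T)).prod η) = t • η := by
        rw [← h]; simp
      rw [this, smul_smul, inv_mul_cancel₀ ht0, one_smul]
    · simp only [x, θ, Fin.cons_succ, Fin.val_succ]
      rw [List.drop_eq_getElem_cons i.2, List.map_cons, List.prod_cons, Module.End.mul_apply]
      rfl
  exact hη (hT.eq_zero_of_cyclic hx hθ 0)

/-- If every eigenvalue of (the transpose of) an endomorphism lies in the closed unit disc, its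
trace is bounded by the dimension. -/
theorem norm_trace_le [FiniteDimensional ℂ V] (B : Module.End ℂ V)
    (h : ∀ (φ : V →ₗ[ℂ] ℂ) (t : ℂ), φ ≠ 0 → φ ∘ₗ B = t • φ → ‖t‖ ≤ 1) :
    ‖LinearMap.trace ℂ V B‖ ≤ Module.finrank ℂ V := by
  rw [Module.End.trace_eq_sum_roots_charpoly_of_splits (IsAlgClosed.splits _)]
  have hroot : ∀ t ∈ B.charpoly.roots, ‖t‖ ≤ 1 := by
    intro t ht
    have hev : B.HasEigenvalue t :=
      (Module.End.hasEigenvalue_iff_isRoot_charpoly B t).2 (Polynomial.isRoot_of_mem_roots ht)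
    have hlt : LinearMap.range (B - algebraMap ℂ (Module.End ℂ V) t) < ⊤ := by
      rw [lt_top_iff_ne_top, Ne, LinearMap.range_eq_top, ← LinearMap.injective_iff_surjective,
        ← LinearMap.ker_eq_bot]
      rw [Module.End.hasEigenvalue_iff, Module.End.eigenspace_def] at hev
      exact hev
    obtain ⟨φ, hφ0, hφ⟩ := Submodule.exists_le_ker_of_lt_top _ hlt
    refine h φ t hφ0 ?_
    ext v
    have := hφ (LinearMap.mem_range_self _ v)
    simpa [sub_eq_zero] using this
  calc ‖B.charpoly.roots.sum‖ ≤ (B.charpoly.roots.map fun t => ‖t‖).sum :=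
        norm_multiset_sum_le _
    _ ≤ (B.charpoly.roots.map fun t => ‖t‖).card • (1 : ℝ) := by
        refine Multiset.sum_le_card_nsmul _ _ fun y hy => ?_
        obtain ⟨t, ht, rfl⟩ := Multiset.mem_map.1 hy
        exact hroot t ht
    _ ≤ _ := by
        rw [Multiset.card_map, nsmul_eq_mul, mul_one]
        exact_mod_cast (Polynomial.card_roots' _).trans (LinearMap.charpoly_natDegree B).le

/-- **Burnside's theorem** over `ℂ`: words in an irreducible tuple span all endomorphisms. -/
theorem span_words_eq_top [FiniteDimensional ℂ V] [Nontrivial V]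
    (hirr : ∀ U : Submodule ℂ V, (∀ j, ∀ h ∈ U, T j h ∈ U) → U = ⊥ ∨ U = ⊤) :
    Submodule.span ℂ (Set.range fun w : List (Fin d) => (w.map T).prod) = ⊤ := by
  set A : Subalgebra ℂ (Module.End ℂ V) := Algebra.adjoin ℂ (Set.range T) with hA
  have hspan : Subalgebra.toSubmodule A =
      Submodule.span ℂ (Set.range fun w : List (Fin d) => (w.map T).prod) := by
    rw [hA, Algebra.adjoin_eq_span]
    congr 1
    ext B
    constructor
    · intro hB
      obtain ⟨L, hL, rfl⟩ := Submonoid.exists_list_of_mem_closure hB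
      obtain ⟨w, rfl⟩ : L ∈ Set.range (List.map T) := by rw [Set.range_list_map]; exact hL
      exact ⟨w, rfl⟩
    · rintro ⟨w, rfl⟩
      refine Submonoid.list_prod_mem _ fun y hy => ?_
      obtain ⟨j, -, rfl⟩ := List.mem_map.1 hy
      exact Submonoid.subset_closure ⟨j, rfl⟩
  rw [← hspan]
  classical
  have hsimple : IsSimpleModule A V := by
    refine IsSimpleModule.mk (toIsSimpleOrder := { exists_pair_ne := ⟨⊥, ⊤, bot_ne_top⟩, eq_bot_or_eq_top := fun U => ?_ })
    rcases hirr (U.restrictScalars ℂ) (fun j h hh =>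
      U.smul_mem (⟨T j, Algebra.subset_adjoin ⟨j, rfl⟩⟩ : A) hh) with h | h
    · left; exact (Submodule.restrictScalars_eq_bot_iff ..).1 h
    · right; exact (Submodule.restrictScalars_eq_top_iff ..).1 h
  rw [Submodule.eq_top_iff']
  intro f
  have hscalar : ∀ g : Module.End A V, ∃ c : ℂ, ∀ v, g v = c • v := by
    intro g
    let g' : Module.End ℂ V := g.restrictScalars ℂ
    obtain ⟨c, hc⟩ := Module.End.exists_eigenvalue g'
    obtain ⟨v, hv⟩ := hc.exists_hasEigenvector
    have hcomm : ∀ (a : A) (u : V), a • (c • u) = c • (a • u) := fun a u => smul_comm _ _ _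
    let k : Submodule A V :=
      { carrier := {u | g u = c • u}
        add_mem' := fun {a b} ha hb => by
          simp only [Set.mem_ofPred_eq] at *; rw [map_add, ha, hb, smul_add]
        zero_mem' := by simp
        smul_mem' := fun a u hu => by
          simp only [Set.mem_ofPred_eq] at *; rw [map_smul, hu, hcomm] }
    have hk : k = ⊤ := by
      refine (eq_bot_or_eq_top k).resolve_left fun hk => hv.2 ?_
      have : v ∈ k := hv.apply_eq_smul
      rwa [hk, Submodule.mem_bot] at this
    exact ⟨c, fun u => (hk ▸ Submodule.mem_top : u ∈ k)⟩
  let F : Module.End (Module.End A V) V :=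
    { toFun := f
      map_add' := map_add f
      map_smul' := fun g v => by
        obtain ⟨c, hc⟩ := hscalar g
        simp only [Module.End.smul_def, hc, map_smul, RingHom.id_apply] }
  let b := Module.finBasis ℂ V
  obtain ⟨a, ha⟩ := jacobson_density (R := A) F (Finset.univ.image b)
  have : f = a := b.ext fun i => ha (b i) (Finset.mem_image_of_mem _ (Finset.mem_univ i))
  rw [this]
  exact a.2

end Pencil

section Irreducible

variable {d l : ℕ} {V : Type} [AddCommGroup V] [Module ℂ V]
  {E : Type} [NormedAddCommGroup E] [InnerProductSpace ℂ E]
  {Q : Fin d → Matrix (Fin l) (Fin l) ℂ} {T : Fin d → Module.End ℂ V}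

theorem exists_compression (T : Fin d → Module.End ℂ V) (x : Fin d → E →L[ℂ] E) (v : E) (m : ℕ) :
    ∀ S : E →L[ℂ] ℂ, ∃ B : Module.End ℂ V, ∀ (φ : V →ₗ[ℂ] ℂ) (h : V),
      φ (B h) = S ((pencil T x ^ m) (φ.smulRight v) h) := by
  induction m with
  | zero => exact fun S => ⟨S v • 1, fun φ h => by simp [mul_comm]⟩
  | succ m ih =>
    intro S
    choose B hB using fun j => ih (S.comp (x j))
    refine ⟨∑ j, B j * T j, fun φ h => ?_⟩
    simp [pow_succ', Module.End.mul_apply, pencil_apply, hB, LinearMap.sum_apply]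

/-- `B` is the compression of a positive power of a pencil over the operator ball to a pair of
unit vectors. -/
def IsCompression (Q : Fin d → Matrix (Fin l) (Fin l) ℂ) (T : Fin d → Module.End ℂ V)
    (B : Module.End ℂ V) : Prop :=
  ∃ (E : Type) (_ : NormedAddCommGroup E) (_ : InnerProductSpace ℂ E)
    (_ : FiniteDimensional ℂ E) (x : Fin d → E →L[ℂ] E) (u v : E) (m : ℕ),
    Ball Q x ∧ ‖u‖ ≤ 1 ∧ ‖v‖ = 1 ∧ ∀ (φ : V →ₗ[ℂ] ℂ) (h : V),
      φ (B h) = innerSL ℂ u ((pencil T x ^ (m + 1)) (φ.smulRight v) h)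

theorem pencil_single_smulRight (T : Fin d → Module.End ℂ V) (ε : ℝ) {v : E} (hv : ‖v‖ = 1)
    (i : Fin d) (φ : V →ₗ[ℂ] ℂ) :
    pencil T (fun j => if j = i then (ε : ℂ) • (innerSL ℂ v).smulRight v else 0)
      (φ.smulRight v) = ((ε : ℂ) • φ ∘ₗ T i).smulRight v := by
  ext h
  rw [pencil_apply, Finset.sum_eq_single i]
  · simp only [if_true, smul_apply, ContinuousLinearMap.smulRight_apply, innerSL_apply_apply,
      LinearMap.smulRight_apply, LinearMap.smul_apply, LinearMap.comp_apply, inner_smul_right,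
      inner_self_eq_norm_sq_to_K, hv, smul_smul, smul_eq_mul]
    congr 1
    simp
  · intro j _ hj; simp [hj]
  · simp

theorem prod_pencil_single_smulRight (T : Fin d → Module.End ℂ V) (ε : ℝ) {v : E} (hv : ‖v‖ = 1)
    (w : List (Fin d)) (φ : V →ₗ[ℂ] ℂ) :
    ((w.reverse.map fun i => pencil T
      fun j => if j = i then (ε : ℂ) • (innerSL ℂ v).smulRight v else 0).prod)
      (φ.smulRight v) = ((ε : ℂ) ^ w.length • φ ∘ₗ (w.map T).prod).smulRight v := by
  induction w generalizing φ with
  | nil => ext; simp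
  | cons i w ih =>
    rw [List.reverse_cons, List.map_append, List.prod_append, Module.End.mul_apply,
      List.map_singleton, List.prod_singleton, pencil_single_smulRight T ε hv, ih]
    congr 1
    ext h
    simp [pow_succ, mul_assoc]

theorem IsCompression.norm_trace_mul_word_le [FiniteDimensional ℂ V] (hT : Stable Q T)
    (w : List (Fin d)) : ∃ K : ℝ, ∀ B : Module.End ℂ V, IsCompression Q T B →
      ‖LinearMap.trace ℂ V (B * (w.map T).prod)‖ ≤ K := by
  obtain ⟨ε, hε0, hε⟩ := exists_ball_single Q
  refine ⟨Module.finrank ℂ V / ε ^ w.length, ?_⟩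
  rintro B ⟨E, _, _, _, x, u, v, m, hx, hu, hv, hB⟩
  have key := norm_trace_le (((ε : ℂ) ^ w.length) • (B * (w.map T).prod)) ?_
  · rw [map_smul, norm_smul, norm_pow, Complex.norm_real, Real.norm_of_nonneg hε0.le] at key
    rw [le_div_iff₀ (by positivity), mul_comm]
    exact key
  · intro φ t hφ ht
    have hη : (φ.smulRight v : V →ₗ[ℂ] E) ≠ 0 := by
      intro h0
      refine hφ (LinearMap.ext fun h => ?_)
      have h1 := LinearMap.congr_fun h0 h
      have hv0 : v ≠ 0 := by rintro rfl; simp at hv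
      simpa [hv0] using h1
    refine (hT.norm_eigenvalue_lt_one
      (L := (w.reverse.map fun i j => if j = i then (ε : ℂ) • (innerSL ℂ v).smulRight v else 0) ++
        ((fun j => ((innerSL ℂ u).comp (x j)).smulRight v) :: List.replicate m x))
      ?_ (by simp) hη (t := t) ?_).le
    · intro y hy
      rw [List.mem_append, List.mem_cons, List.mem_map] at hy
      rcases hy with ⟨i, -, rfl⟩ | rfl | hy
      · exact hε E v hv.le i
      · exact hx.rankOne hu hv.le
      · rw [List.eq_of_mem_replicate hy]; exact hx
    · have h1 : pencil T (fun j => ((innerSL ℂ u).comp (x j)).smulRight v)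
          ((pencil T x ^ m) (φ.smulRight v)) = (φ ∘ₗ B).smulRight v := by
        ext h
        rw [LinearMap.smulRight_apply, LinearMap.comp_apply, hB, pow_succ', Module.End.mul_apply,
          pencil_apply, pencil_apply, map_sum, Finset.sum_smul]
        rfl
      rw [List.map_append, List.prod_append, List.map_cons, List.prod_cons, List.map_replicate,
        List.prod_replicate, Module.End.mul_apply, Module.End.mul_apply, h1, List.map_map]
      have h2 := prod_pencil_single_smulRight T ε hv w (φ ∘ₗ B)
      refine h2.trans ?_
      have h3 : (ε : ℂ) ^ w.length • (φ ∘ₗ B) ∘ₗ (w.map T).prod = t • φ := by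
        rw [← ht]; ext; simp
      rw [h3]
      ext; simp [smul_smul]

theorem IsCompression.norm_trace_mul_le [FiniteDimensional ℂ V] [Nontrivial V] (hT : Stable Q T)
    (hirr : ∀ U : Submodule ℂ V, (∀ j, ∀ h ∈ U, T j h ∈ U) → U = ⊥ ∨ U = ⊤)
    (R : Module.End ℂ V) : ∃ K : ℝ, ∀ B : Module.End ℂ V, IsCompression Q T B →
      ‖LinearMap.trace ℂ V (B * R)‖ ≤ K := by
  have hR : R ∈ Submodule.span ℂ (Set.range fun w : List (Fin d) => (w.map T).prod) := by
    rw [span_words_eq_top hirr]; trivial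
  induction hR using Submodule.span_induction with
  | mem R hR =>
    obtain ⟨w, rfl⟩ := hR
    exact IsCompression.norm_trace_mul_word_le hT w
  | zero => exact ⟨0, by simp⟩
  | add R S _ _ hR hS =>
    obtain ⟨K, hK⟩ := hR
    obtain ⟨K', hK'⟩ := hS
    refine ⟨K + K', fun B hB => ?_⟩
    rw [mul_add, map_add]
    exact (norm_add_le _ _).trans (add_le_add (hK B hB) (hK' B hB))
  | smul c R _ hR =>
    obtain ⟨K, hK⟩ := hR
    refine ⟨‖c‖ * K, fun B hB => ?_⟩
    rw [mul_smul_comm, map_smul, norm_smul]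
    exact mul_le_mul_of_nonneg_left (hK B hB) (norm_nonneg _)

/-- Powers of an irreducible stable pencil are uniformly bounded over the operator ball. -/
theorem exists_norm_pencil_pow_smulRight_le [FiniteDimensional ℂ V] [Nontrivial V]
    (hT : Stable Q T)
    (hirr : ∀ U : Submodule ℂ V, (∀ j, ∀ h ∈ U, T j h ∈ U) → U = ⊥ ∨ U = ⊤)
    (φ : V →ₗ[ℂ] ℂ) (h : V) : ∃ C : ℝ, 0 ≤ C ∧ ∀ (E : Type) [NormedAddCommGroup E]
      [InnerProductSpace ℂ E] [FiniteDimensional ℂ E] (x : Fin d → E →L[ℂ] E), Ball Q x →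
      ∀ (m : ℕ) (v : E), ‖(pencil T x ^ m) (φ.smulRight v) h‖ ≤ C * ‖v‖ := by
  obtain ⟨K, hK⟩ := IsCompression.norm_trace_mul_le hT hirr (φ.smulRight h)
  have hK' : ∀ B, IsCompression Q T B → ‖φ (B h)‖ ≤ K := by
    intro B hB
    have := hK B hB
    have h1 : B * φ.smulRight h = φ.smulRight (B h) := by ext; simp
    rwa [h1, LinearMap.trace_smulRight] at this
  refine ⟨max K ‖φ h‖, le_max_of_le_right (norm_nonneg _), fun E _ _ _ x hx m v => ?_⟩
  rcases m with _ | m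
  · simp only [pow_zero, Module.End.one_apply, LinearMap.smulRight_apply, norm_smul]
    exact mul_le_mul_of_nonneg_right (le_max_right _ _) (norm_nonneg _)
  have hunit : ∀ v : E, ‖v‖ = 1 → ‖(pencil T x ^ (m + 1)) (φ.smulRight v) h‖ ≤ max K ‖φ h‖ := by
    intro v hv
    set z := (pencil T x ^ (m + 1)) (φ.smulRight v) h with hz
    rcases eq_or_ne z 0 with h0 | h0
    · rw [h0, norm_zero]; exact le_max_of_le_right (norm_nonneg _)
    set u : E := ((‖z‖ : ℂ)⁻¹) • z with hu
    have hz0 : (‖z‖ : ℂ) ≠ 0 := by simpa using h0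
    have hun : ‖u‖ = 1 := by
      rw [hu, norm_smul, norm_inv, Complex.norm_real, norm_norm, inv_mul_cancel₀ (by simpa using h0)]
    obtain ⟨B, hB⟩ := exists_compression T x v (m + 1) (innerSL ℂ u)
    have h1 := hK' B ⟨E, _, _, inferInstance, x, u, v, m, hx, hun.le, hv, hB⟩
    rw [hB, ← hz, innerSL_apply_apply, hu, inner_smul_left, inner_self_eq_norm_sq_to_K] at h1
    have h2 : ‖(starRingEnd ℂ) (‖z‖ : ℂ)⁻¹ * ((‖z‖ : ℂ)) ^ 2‖ = ‖z‖ := by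
      rw [norm_mul, RCLike.norm_conj, norm_inv, norm_pow, Complex.norm_real, norm_norm, sq,
        inv_mul_cancel_left₀ (by simpa using h0)]
    exact (h2.symm.le.trans h1).trans (le_max_left _ _)
  rcases eq_or_ne v 0 with rfl | hv
  · have : φ.smulRight (0 : E) = 0 := by ext; simp
    simp [this]
  have hv0 : (‖v‖ : ℂ) ≠ 0 := by simpa using hv
  have hsplit : φ.smulRight v = (‖v‖ : ℂ) • φ.smulRight ((‖v‖ : ℂ)⁻¹ • v) := by
    ext g
    simp only [LinearMap.smul_apply, LinearMap.smulRight_apply, smul_smul]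
    congr 1
    field_simp
  rw [hsplit, map_smul, LinearMap.smul_apply, norm_smul, Complex.norm_real, norm_norm, mul_comm]
  refine mul_le_mul_of_nonneg_right (hunit _ ?_) (norm_nonneg _)
  rw [norm_smul, norm_inv, Complex.norm_real, norm_norm, inv_mul_cancel₀ (by simpa using hv)]

theorem eq_pow_add_sum {W : Type*} [AddCommGroup W] [Module ℂ W] (A : Module.End ℂ W) {η y : W}
    (h : η = A η + y) (N : ℕ) : η = (A ^ N) η + ∑ i ∈ Finset.range N, (A ^ i) y := by
  induction N with
  | zero => simp
  | succ N ih =>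
    conv_lhs => rw [ih]
    rw [Finset.sum_range_succ_comm, ← add_assoc, pow_succ, Module.End.mul_apply, ← map_add, ← h]

theorem resolventBound_of_irreducible [FiniteDimensional ℂ V] [Nontrivial V] (hT : Stable Q T)
    (hirr : ∀ U : Submodule ℂ V, (∀ j, ∀ h ∈ U, T j h ∈ U) → U = ⊥ ∨ U = ⊤) :
    ResolventBound Q T := by
  intro h
  set b := Module.finBasis ℂ V with hb
  choose C hC0 hC using fun a => exists_norm_pencil_pow_smulRight_le hT hirr (b.coord a) h
  refine ⟨∑ a, C a, Finset.sum_nonneg fun a _ => hC0 a, fun E _ _ _ x hx r hr0 hr1 η y heq M hM => ?_⟩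
  have hpow : ∀ (θ : V →ₗ[ℂ] E) (M : ℝ), (∀ a, ‖θ (b a)‖ ≤ M) → ∀ m : ℕ,
      ‖(((r : ℂ) • pencil T x) ^ m) θ h‖ ≤ r ^ m * ((∑ a, C a) * M) := by
    intro θ M hM m
    have hθ : θ = ∑ a, (b.coord a).smulRight (θ (b a)) := by
      refine b.ext fun a => ?_
      simp [LinearMap.sum_apply, Finsupp.single_apply]
    rw [smul_pow, LinearMap.smul_apply, LinearMap.smul_apply, norm_smul, norm_pow,
      Complex.norm_real, Real.norm_of_nonneg hr0]
    refine mul_le_mul_of_nonneg_left ?_ (pow_nonneg hr0 m)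
    conv_lhs => rw [hθ]
    rw [map_sum, LinearMap.sum_apply, Finset.sum_mul]
    refine (norm_sum_le _ _).trans (Finset.sum_le_sum fun a _ => (hC a E x hx m _).trans ?_)
    exact mul_le_mul_of_nonneg_left (hM a) (hC0 a)
  obtain ⟨M', hM'⟩ : ∃ M', ∀ a, ‖η (b a)‖ ≤ M' :=
    ⟨∑ a, ‖η (b a)‖, fun a => Finset.single_le_sum (f := fun a => ‖η (b a)‖)
      (fun _ _ => norm_nonneg _) (Finset.mem_univ a)⟩
  have hN : ∀ N : ℕ, ‖η h‖ ≤ r ^ N * ((∑ a, C a) * M') +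
      (∑ i ∈ Finset.range N, r ^ i) * ((∑ a, C a) * M) := by
    intro N
    have h1 := eq_pow_add_sum ((r : ℂ) • pencil T x) heq N
    conv_lhs => rw [h1]
    rw [LinearMap.add_apply, LinearMap.sum_apply, Finset.sum_mul (Finset.range N)]
    exact (norm_add_le _ _).trans (add_le_add (hpow η M' hM' N)
      ((norm_sum_le _ _).trans (Finset.sum_le_sum fun i _ => hpow y M hM i)))
  have hlim := ((tendsto_pow_atTop_nhds_zero_of_lt_one hr0 hr1).mul_const ((∑ a, C a) * M')).add
    ((hasSum_geometric_of_lt_one hr0 hr1).tendsto_sum_nat.mul_const ((∑ a, C a) * M))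
  refine (ge_of_tendsto' hlim hN).trans (le_of_eq ?_)
  rw [zero_mul, zero_add]
  ring

end Irreducible

section Induction

variable {d l : ℕ} {V V' : Type} [AddCommGroup V] [Module ℂ V] [AddCommGroup V'] [Module ℂ V']
  {Q : Fin d → Matrix (Fin l) (Fin l) ℂ} {T : Fin d → Module.End ℂ V}
  {S : Fin d → Module.End ℂ V'}

/-- Every invariant subspace of the tuple is either annihilated by all long words, or contains
the range of all long words. -/
def Dichotomy (T : Fin d → Module.End ℂ V) : Prop :=
  ∀ U : Submodule ℂ V, (∀ j, ∀ h ∈ U, T j h ∈ U) →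
    (∃ m, ∀ w : List (Fin d), w.length = m → ∀ h ∈ U, (w.map T).prod h = 0) ∨
    (∃ m, ∀ w : List (Fin d), w.length = m → ∀ h, (w.map T).prod h ∈ U)

theorem prod_map_intertwine {f : V →ₗ[ℂ] V'} (hf : ∀ j h, S j (f h) = f (T j h))
    (w : List (Fin d)) (h : V) : (w.map S).prod (f h) = f ((w.map T).prod h) := by
  induction w with
  | nil => simp
  | cons i w ih => simp [ih, hf]

theorem Stable.of_surjective {f : V →ₗ[ℂ] V'} (hf : ∀ j h, S j (f h) = f (T j h))
    (hsurj : Function.Surjective f) (hT : Stable Q T) : Stable Q S := by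
  intro E _ _ _ x hx η hη
  have h0 : η ∘ₗ f = 0 := by
    refine hT E x hx _ (LinearMap.ext fun h => ?_)
    have := LinearMap.congr_fun hη (f h)
    rw [pencil_apply] at this
    simpa [pencil_apply, hf] using this
  ext u
  obtain ⟨h, rfl⟩ := hsurj u
  exact LinearMap.congr_fun h0 h

theorem Dichotomy.of_surjective {f : V →ₗ[ℂ] V'} (hf : ∀ j h, S j (f h) = f (T j h))
    (hsurj : Function.Surjective f) (hT : Dichotomy T) : Dichotomy S := by
  intro U hU
  rcases hT (U.comap f) (fun j h hh => by
    rw [Submodule.mem_comap, ← hf]; exact hU j _ hh) with ⟨m, hm⟩ | ⟨m, hm⟩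
  · refine Or.inl ⟨m, fun w hw u hu => ?_⟩
    obtain ⟨h, rfl⟩ := hsurj u
    rw [prod_map_intertwine hf, hm w hw h hu, map_zero]
  · refine Or.inr ⟨m, fun w hw u => ?_⟩
    obtain ⟨h, rfl⟩ := hsurj u
    rw [prod_map_intertwine hf]
    exact hm w hw h

theorem Stable.of_factor {f : V' →ₗ[ℂ] V} {g : Fin d → V →ₗ[ℂ] V'} (hfg : ∀ j h, f (g j h) = T j h)
    (hgf : ∀ j u, g j (f u) = S j u) (hT : Stable Q T) : Stable Q S := by
  intro E _ _ _ x hx η hη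
  let θ : V →ₗ[ℂ] E := ∑ j, (x j : E →ₗ[ℂ] E) ∘ₗ η ∘ₗ g j
  have hθ : ∀ h, θ h = ∑ j, x j (η (g j h)) := fun h => by simp [θ]
  have hθf : ∀ u, θ (f u) = η u := fun u => by
    rw [hθ]
    conv_rhs => rw [← hη, pencil_apply]
    simp [hgf]
  have h0 : θ = 0 := by
    refine hT E x hx _ (LinearMap.ext fun h => ?_)
    rw [pencil_apply, hθ]
    simp [← hfg, hθf]
  ext u
  rw [← hθf, h0]
  simp

theorem Dichotomy.of_injective {f : V' →ₗ[ℂ] V} (hf : ∀ j u, T j (f u) = f (S j u))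
    (hinj : Function.Injective f) (hT : Dichotomy T) : Dichotomy S := by
  intro U hU
  rcases hT (U.map f) (by
    rintro j _ ⟨u, hu, rfl⟩
    exact ⟨S j u, hU j u hu, (hf j u).symm⟩) with ⟨m, hm⟩ | ⟨m, hm⟩
  · refine Or.inl ⟨m, fun w hw u hu => hinj ?_⟩
    rw [← prod_map_intertwine hf, hm w hw _ ⟨u, hu, rfl⟩, map_zero]
  · refine Or.inr ⟨m, fun w hw u => ?_⟩
    obtain ⟨u', hu', h⟩ := hm w hw (f u)
    rw [prod_map_intertwine hf] at h
    exact hinj h ▸ hu'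

theorem exists_norm_le_of_basis [FiniteDimensional ℂ V] (h : V) : ∃ c : ℝ, 0 ≤ c ∧
    ∀ (E : Type) [NormedAddCommGroup E] [InnerProductSpace ℂ E] (y : V →ₗ[ℂ] E) (M : ℝ),
      (∀ a, ‖y (Module.finBasis ℂ V a)‖ ≤ M) → ‖y h‖ ≤ c * M := by
  set b := Module.finBasis ℂ V
  refine ⟨∑ a, ‖b.repr h a‖, Finset.sum_nonneg fun _ _ => norm_nonneg _, fun E _ _ y M hM => ?_⟩
  conv_lhs => rw [← b.sum_repr h, map_sum]
  rw [Finset.sum_mul]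
  refine (norm_sum_le _ _).trans (Finset.sum_le_sum fun a _ => ?_)
  rw [map_smul, norm_smul]
  exact mul_le_mul_of_nonneg_left (hM a) (norm_nonneg _)

/-- Bound for linear maps of the form `u ↦ ∑ j, x j (y (g j u))`. -/
theorem exists_norm_sum_le [FiniteDimensional ℂ V] (hQ : LinearIndependent ℂ Q)
    (u : Fin d → V) : ∃ c : ℝ, 0 ≤ c ∧
    ∀ (E : Type) [NormedAddCommGroup E] [InnerProductSpace ℂ E] [FiniteDimensional ℂ E]
      (x : Fin d → E →L[ℂ] E), Ball Q x → ∀ (y : V →ₗ[ℂ] E) (M : ℝ),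
      (∀ a, ‖y (Module.finBasis ℂ V a)‖ ≤ M) → ‖∑ j, x j (y (u j))‖ ≤ c * M := by
  obtain ⟨K, hK0, hK⟩ := Ball.norm_le hQ
  choose c hc0 hc using fun j => exists_norm_le_of_basis (u j)
  refine ⟨∑ j, K * c j, Finset.sum_nonneg fun j _ => mul_nonneg hK0 (hc0 j),
    fun E _ _ _ x hx y M hM => ?_⟩
  rw [Finset.sum_mul]
  refine (norm_sum_le _ _).trans (Finset.sum_le_sum fun j _ => (hK E x hx j _).trans ?_)
  rw [mul_assoc]
  exact mul_le_mul_of_nonneg_left (hc j E y M hM) hK0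

theorem nonneg_of_basis_bound [FiniteDimensional ℂ V] [Nontrivial V] {E : Type}
    [NormedAddCommGroup E] [InnerProductSpace ℂ E] {y : V →ₗ[ℂ] E} {M : ℝ}
    (hM : ∀ a, ‖y (Module.finBasis ℂ V a)‖ ≤ M) : 0 ≤ M :=
  (norm_nonneg _).trans (hM ⟨0, Module.finrank_pos⟩)

theorem add_le_div_one_sub_mul {a b M r : ℝ} (hb : 0 ≤ b) (hM : 0 ≤ M) (hr0 : 0 ≤ r)
    (hr1 : r < 1) : a / (1 - r) * M + b * M ≤ (a + b) / (1 - r) * M := by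
  rw [← add_mul, add_div]
  refine mul_le_mul_of_nonneg_right (add_le_add_right ?_ _) hM
  rw [le_div_iff₀ (by linarith)]
  nlinarith

/-- The resolvent bound passes from `f ∘ g j` to `g j ∘ f`. -/
theorem ResolventBound.swap [FiniteDimensional ℂ V] [FiniteDimensional ℂ V'] [Nontrivial V]
    (hQ : LinearIndependent ℂ Q) {f : V →ₗ[ℂ] V'} {g : Fin d → V' →ₗ[ℂ] V}
    (hgf : ∀ j h, g j (f h) = T j h) (hfg : ∀ j u, f (g j u) = S j u)
    (hS : ResolventBound Q S) : ResolventBound Q T := by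
  intro h
  obtain ⟨C, hC0, hC⟩ := hS (f h)
  obtain ⟨c, hc0, hc⟩ := exists_norm_le_of_basis h
  choose c' hc'0 hc' using fun a => exists_norm_sum_le hQ (fun j => g j (Module.finBasis ℂ V' a))
  have hs0 : 0 ≤ ∑ a, c' a := Finset.sum_nonneg fun a _ => hc'0 a
  refine ⟨C * (∑ a, c' a) + c, by positivity, fun E _ _ _ x hx r hr0 hr1 η y heq M hM => ?_⟩
  have hM0 := nonneg_of_basis_bound hM
  have hη : ∀ h, η h = (r : ℂ) • ∑ j, x j (η (T j h)) + y h := fun h => by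
    conv_lhs => rw [heq]
    rw [LinearMap.add_apply, LinearMap.smul_apply, pencil_apply]
  obtain ⟨A, hA⟩ : ∃ A : (V →ₗ[ℂ] E) → V' →ₗ[ℂ] E,
      ∀ θ u, A θ u = (r : ℂ) • ∑ j, x j (θ (g j u)) :=
    ⟨fun θ => (r : ℂ) • ∑ j, (x j : E →ₗ[ℂ] E) ∘ₗ θ ∘ₗ g j, fun θ u => by simp⟩
  have hηA : ∀ h, η h = A η (f h) + y h := fun h => by rw [hη, hA]; simp [hgf]
  have hrec : A η = (r : ℂ) • pencil S x (A η) + A y := by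
    refine LinearMap.ext fun u => ?_
    rw [LinearMap.add_apply, LinearMap.smul_apply, pencil_apply, hA η u, hA y u, ← smul_add,
      ← Finset.sum_add_distrib]
    congr 1
    refine Finset.sum_congr rfl fun j _ => ?_
    rw [hηA (g j u), map_add, hfg]
  have hy : ∀ a, ‖A y (Module.finBasis ℂ V' a)‖ ≤ (∑ a, c' a) * M := by
    intro a
    rw [hA, norm_smul, Complex.norm_real, Real.norm_of_nonneg hr0]
    refine (mul_le_of_le_one_left (norm_nonneg _) hr1.le).trans
      ((hc' a E x hx y M hM).trans (mul_le_mul_of_nonneg_right ?_ hM0))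
    exact Finset.single_le_sum (fun a _ => hc'0 a) (Finset.mem_univ a)
  rw [hηA]
  refine (norm_add_le _ _).trans ((add_le_add (hC E x hx r hr0 hr1 _ _ hrec _ hy)
    (hc E y M hM)).trans (le_trans (le_of_eq ?_) (add_le_div_one_sub_mul hc0 hM0 hr0 hr1)))
  ring

theorem eq_bot_or_eq_top_of_dichotomy (hT : Dichotomy T)
    (hK : ∀ h, (∀ j, T j h = 0) → h = 0) (hR : ⨆ j, LinearMap.range (T j) = ⊤)
    (U : Submodule ℂ V) (hU : ∀ j, ∀ h ∈ U, T j h ∈ U) : U = ⊥ ∨ U = ⊤ := by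
  rcases hT U hU with ⟨m, hm⟩ | ⟨m, hm⟩
  · left
    rw [Submodule.eq_bot_iff]
    induction m with
    | zero => exact fun h hh => hm [] rfl h hh
    | succ m ih =>
      refine ih fun w hw h hh => hK _ fun j => ?_
      simpa using hm (j :: w) (by simp [hw]) h hh
  · right
    rw [Submodule.eq_top_iff']
    induction m with
    | zero => exact fun h => hm [] rfl h
    | succ m ih =>
      refine ih fun w hw h => ?_
      have h1 : ⨆ j, LinearMap.range (T j) ≤ U.comap (w.map T).prod := by
        refine iSup_le fun j => ?_
        rintro _ ⟨h, rfl⟩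
        simpa using hm (w ++ [j]) (by simp [hw]) h
      rw [hR] at h1
      exact h1 (Submodule.mem_top : h ∈ ⊤)

/-- A stable pencil satisfying the dichotomy has simple growth at the boundary of the ball. -/
theorem resolventBound_of_dichotomy (hQ : LinearIndependent ℂ Q) (n : ℕ) :
    ∀ (V : Type) [AddCommGroup V] [Module ℂ V] [FiniteDimensional ℂ V]
      (T : Fin d → Module.End ℂ V), Module.finrank ℂ V = n → Stable Q T → Dichotomy T →
      ResolventBound Q T := by
  induction n using Nat.strong_induction_on with
  | _ n ih =>
  intro V _ _ _ T hn hT hD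
  rcases subsingleton_or_nontrivial V with hV | hV
  · refine fun h => ⟨0, le_rfl, fun E _ _ _ x hx r hr0 hr1 η y heq M hM => ?_⟩
    rw [Subsingleton.elim h 0]
    simp
  by_cases hK : ∀ h, (∀ j, T j h = 0) → h = 0
  · by_cases hR : ⨆ j, LinearMap.range (T j) = ⊤
    · exact resolventBound_of_irreducible hT (eq_bot_or_eq_top_of_dichotomy hD hK hR)
    · set U := ⨆ j, LinearMap.range (T j) with hU
      have hmem : ∀ j h, T j h ∈ U := fun j h =>
        (le_iSup (fun j => LinearMap.range (T j)) j) ⟨h, rfl⟩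
      let g : Fin d → V →ₗ[ℂ] U := fun j => (T j).codRestrict U (hmem j)
      let S : Fin d → Module.End ℂ U := fun j => g j ∘ₗ U.subtype
      have hS : ResolventBound Q S := ih (Module.finrank ℂ U)
        (hn ▸ Submodule.finrank_lt hR) U S rfl
        (hT.of_factor (f := U.subtype) (g := g) (fun j h => rfl) fun j u => rfl)
        (hD.of_injective (f := U.subtype) (fun j u => rfl) U.subtype_injective)
      intro h
      choose C hC0 hC using fun j => hS (g j h)
      obtain ⟨K, hK0, hK⟩ := Ball.norm_le hQ
      obtain ⟨c, hc0, hc⟩ := exists_norm_le_of_basis h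
      choose c' hc'0 hc' using fun a =>
        exists_norm_le_of_basis ((Module.finBasis ℂ U a : U) : V)
      have hs0 : 0 ≤ ∑ a, c' a := Finset.sum_nonneg fun a _ => hc'0 a
      refine ⟨(∑ j, K * C j) * (∑ a, c' a) + c, add_nonneg (mul_nonneg
        (Finset.sum_nonneg fun j _ => mul_nonneg hK0 (hC0 j)) hs0) hc0,
        fun E _ _ _ x hx r hr0 hr1 η y heq M hM => ?_⟩
      have hM0 := nonneg_of_basis_bound hM
      have hη : ∀ h, η h = (r : ℂ) • ∑ j, x j (η (T j h)) + y h := fun h => by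
        conv_lhs => rw [heq]
        rw [LinearMap.add_apply, LinearMap.smul_apply, pencil_apply]
      have hrec : η ∘ₗ U.subtype = (r : ℂ) • pencil S x (η ∘ₗ U.subtype) + y ∘ₗ U.subtype := by
        ext u
        rw [LinearMap.add_apply, LinearMap.smul_apply, pencil_apply]
        exact hη u
      have hy : ∀ a, ‖(y ∘ₗ U.subtype) (Module.finBasis ℂ U a)‖ ≤ (∑ a, c' a) * M := fun a =>
        (hc' a E y M hM).trans (mul_le_mul_of_nonneg_right
          (Finset.single_le_sum (fun a _ => hc'0 a) (Finset.mem_univ a)) hM0)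
      rw [hη]
      refine (norm_add_le _ _).trans ((add_le_add (?_ : _ ≤
        ((∑ j, K * C j) * (∑ a, c' a)) / (1 - r) * M) (hc E y M hM)).trans
        (add_le_div_one_sub_mul hc0 hM0 hr0 hr1))
      rw [norm_smul, Complex.norm_real, Real.norm_of_nonneg hr0]
      refine (mul_le_of_le_one_left (norm_nonneg _) hr1.le).trans ((norm_sum_le _ _).trans ?_)
      rw [Finset.sum_mul, Finset.sum_div, Finset.sum_mul]
      refine Finset.sum_le_sum fun j _ => (hK E x hx j _).trans ?_
      have := hC j E x hx r hr0 hr1 _ _ hrec _ hy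
      calc K * ‖η (T j h)‖ ≤ K * (C j / (1 - r) * ((∑ a, c' a) * M)) :=
            mul_le_mul_of_nonneg_left this hK0
        _ = _ := by ring
  · push Not at hK
    obtain ⟨h, hh, h0⟩ := hK
    let K : Submodule ℂ V := ⨅ j, LinearMap.ker (T j)
    have hmem : h ∈ K := (Submodule.mem_iInf _).2 hh
    let g : Fin d → V ⧸ K →ₗ[ℂ] V := fun j => K.liftQ (T j) (iInf_le _ j)
    have hg : ∀ j h, g j (K.mkQ h) = T j h := fun j h => K.liftQ_apply _ _
    let S : Fin d → Module.End ℂ (V ⧸ K) := fun j => K.mkQ ∘ₗ g j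
    have hlt : Module.finrank ℂ (V ⧸ K) < n := by
      rw [← hn, ← K.finrank_quotient_add_finrank]
      have : Nontrivial K := ⟨⟨⟨h, hmem⟩, 0, fun e => h0 (congrArg Subtype.val e)⟩⟩
      have := Module.finrank_pos (R := ℂ) (M := K)
      omega
    have hint : ∀ j h, S j (K.mkQ h) = K.mkQ (T j h) := fun j h => by
      rw [← hg j h]; rfl
    exact (ih _ hlt (V ⧸ K) S rfl (hT.of_surjective hint K.mkQ_surjective)
      (hD.of_surjective hint K.mkQ_surjective)).swap hQ hg fun j u => rfl

end Induction

section FreeAlgebra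

variable {d k : ℕ}

/-- The free algebra `ℂ⟨Z₁,…,Z_d⟩`. -/
abbrev FA (d : ℕ) : Type := FreeAlgebra ℂ (Fin d)

/-- The constant term of a free polynomial. -/
noncomputable abbrev aug : FA d →ₐ[ℂ] ℂ := FreeAlgebra.algebraMapInv

/-- The upper triangular representation encoding the backward shift. -/
noncomputable def shiftHom (j : Fin d) : FA d →ₐ[ℂ] Matrix (Fin 2) (Fin 2) (FA d) :=
  FreeAlgebra.lift ℂ fun i => !![0, if i = j then 1 else 0; 0, FreeAlgebra.ι ℂ i]

/-- The backward shift `Z_i g ↦ δ_{ij} g`. -/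
noncomputable def shift (j : Fin d) : FA d →ₗ[ℂ] FA d where
  toFun a := shiftHom j a 0 1
  map_add' a b := by simp
  map_smul' c a := by simp

theorem aug_ι (i : Fin d) : aug (FreeAlgebra.ι ℂ i) = 0 := by
  simp [aug, FreeAlgebra.algebraMapInv]

theorem shiftHom_entries (j : Fin d) (a : FA d) :
    shiftHom j a 0 0 = algebraMap ℂ (FA d) (aug a) ∧ shiftHom j a 1 0 = 0 ∧
      shiftHom j a 1 1 = a := by
  induction a using FreeAlgebra.induction with
  | grade0 r =>
    rw [AlgHom.commutes, AlgHom.commutes]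
    simp [Matrix.algebraMap_matrix_apply]
  | grade1 i => rw [aug_ι]; simp [shiftHom]
  | mul a b ha hb =>
    obtain ⟨ha1, ha2, ha3⟩ := ha
    obtain ⟨hb1, hb2, hb3⟩ := hb
    simp [map_mul, Matrix.mul_apply, Fin.sum_univ_two, *]
  | add a b ha hb =>
    obtain ⟨ha1, ha2, ha3⟩ := ha
    obtain ⟨hb1, hb2, hb3⟩ := hb
    simp [map_add, *]

theorem shift_mul (j : Fin d) (a b : FA d) :
    shift j (a * b) = aug a • shift j b + shift j a * b := by
  obtain ⟨ha1, -, -⟩ := shiftHom_entries j a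
  obtain ⟨-, -, hb3⟩ := shiftHom_entries j b
  change shiftHom j (a * b) 0 1 = aug a • shiftHom j b 0 1 + shiftHom j a 0 1 * b
  rw [map_mul, Matrix.mul_apply, Fin.sum_univ_two, ha1, hb3, Algebra.smul_def]

theorem shift_algebraMap (j : Fin d) (c : ℂ) : shift j (algebraMap ℂ (FA d) c) = 0 := by
  change shiftHom j _ 0 1 = 0
  rw [AlgHom.commutes]
  simp [Matrix.algebraMap_matrix_apply]

theorem shift_one (j : Fin d) : shift j (1 : FA d) = 0 := by
  rw [← map_one (algebraMap ℂ (FA d)), shift_algebraMap]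

theorem shift_ι (j i : Fin d) : shift j (FreeAlgebra.ι ℂ i) = if i = j then 1 else 0 := by
  change shiftHom j _ 0 1 = _
  simp [shiftHom]

theorem shift_ι_mul (j i : Fin d) (a : FA d) :
    shift j (FreeAlgebra.ι ℂ i * a) = if i = j then a else 0 := by
  rw [shift_mul, aug_ι, zero_smul, zero_add, shift_ι]
  split_ifs <;> simp

theorem eq_aug_add_sum_shift (a : FA d) :
    a = algebraMap ℂ (FA d) (aug a) + ∑ j, FreeAlgebra.ι ℂ j * shift j a := by
  induction a using FreeAlgebra.induction with
  | grade0 r => simp [shift_algebraMap]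
  | grade1 i => simp [shift_ι, FreeAlgebra.algebraMapInv]
  | mul a b ha hb =>
    have h1 : ∑ j, FreeAlgebra.ι ℂ j * shift j (a * b) =
        aug a • (∑ j, FreeAlgebra.ι ℂ j * shift j b) +
          (∑ j, FreeAlgebra.ι ℂ j * shift j a) * b := by
      rw [Finset.smul_sum, Finset.sum_mul, ← Finset.sum_add_distrib]
      refine Finset.sum_congr rfl fun j _ => ?_
      rw [shift_mul, mul_add, mul_smul_comm, mul_assoc]
    have ha' := sub_eq_of_eq_add' ha
    have hb' := sub_eq_of_eq_add' hb
    rw [h1, ← ha', ← hb', map_mul, map_mul, Algebra.smul_def]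
    noncomm_ring
  | add a b ha hb =>
    conv_lhs => rw [ha, hb]
    simp only [map_add, mul_add, Finset.sum_add_distrib]
    abel

/-- The free polynomials of degree less than `m`. -/
noncomputable def filt : ℕ → Submodule ℂ (FA d)
  | 0 => ⊥
  | m + 1 => ⨅ j, (filt m).comap (shift j)

theorem mem_filt_succ {m : ℕ} {a : FA d} : a ∈ filt (m + 1) ↔ ∀ j, shift j a ∈ filt m := by
  simp [filt, Submodule.mem_iInf]

theorem filt_le_succ (m : ℕ) : filt (d := d) m ≤ filt (m + 1) := by
  induction m with
  | zero => exact bot_le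
  | succ m ih => exact fun a ha => mem_filt_succ.2 fun j => ih (mem_filt_succ.1 ha j)

theorem filt_mono : Monotone (filt (d := d)) := monotone_nat_of_le_succ filt_le_succ

theorem shift_mem_filt {m : ℕ} {a : FA d} (ha : a ∈ filt m) (j : Fin d) : shift j a ∈ filt m :=
  mem_filt_succ.1 (filt_le_succ m ha) j

theorem mul_mem_filt {m n : ℕ} {a b : FA d} (ha : a ∈ filt m) (hb : b ∈ filt n) :
    a * b ∈ filt (m + n) := by
  induction m generalizing a with
  | zero =>
    rw [show a = 0 from ha, zero_mul]
    exact zero_mem _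
  | succ m ih =>
    rw [Nat.succ_add, mem_filt_succ]
    intro j
    rw [shift_mul]
    exact add_mem (Submodule.smul_mem _ _ (filt_mono (Nat.le_add_left n m) (shift_mem_filt hb j)))
      (ih (mem_filt_succ.1 ha j))

theorem algebraMap_mem_filt (c : ℂ) : algebraMap ℂ (FA d) c ∈ filt 1 :=
  mem_filt_succ.2 fun j => by rw [shift_algebraMap]; exact zero_mem _

theorem exists_mem_filt (a : FA d) : ∃ m, a ∈ filt m := by
  induction a using FreeAlgebra.induction with
  | grade0 r => exact ⟨1, algebraMap_mem_filt r⟩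
  | grade1 i =>
    refine ⟨2, mem_filt_succ.2 fun j => ?_⟩
    rw [shift_ι]
    split_ifs
    · exact map_one (algebraMap ℂ (FA d)) ▸ algebraMap_mem_filt 1
    · exact zero_mem _
  | mul a b ha hb =>
    obtain ⟨m, hm⟩ := ha
    obtain ⟨n, hn⟩ := hb
    exact ⟨m + n, mul_mem_filt hm hn⟩
  | add a b ha hb =>
    obtain ⟨m, hm⟩ := ha
    obtain ⟨n, hn⟩ := hb
    exact ⟨max m n, add_mem (filt_mono (le_max_left _ _) hm) (filt_mono (le_max_right _ _) hn)⟩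

theorem finiteDimensional_filt (m : ℕ) : FiniteDimensional ℂ (filt (d := d) m) := by
  induction m with
  | zero => exact inferInstanceAs (FiniteDimensional ℂ (⊥ : Submodule ℂ (FA d)))
  | succ m ih =>
    have h : filt (d := d) (m + 1) ≤ Submodule.span ℂ {1} ⊔
        ⨆ j, (filt m).map (LinearMap.mulLeft ℂ (FreeAlgebra.ι ℂ j)) := by
      intro a ha
      rw [eq_aug_add_sum_shift a, Algebra.algebraMap_eq_smul_one]
      refine add_mem (Submodule.mem_sup_left
        (Submodule.smul_mem _ _ (Submodule.mem_span_singleton_self _)))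
        (Submodule.mem_sup_right (sum_mem fun j _ => ?_))
      exact Submodule.mem_iSup_of_mem j ⟨_, mem_filt_succ.1 ha j, rfl⟩
    exact Submodule.finiteDimensional_of_le h

/-- Rows of free polynomials of degree less than `m`. -/
noncomputable def rowFilt (k m : ℕ) : Submodule ℂ (Fin k → FA d) :=
  Submodule.pi Set.univ fun _ => filt m

theorem mem_rowFilt {m : ℕ} {h : Fin k → FA d} : h ∈ rowFilt k m ↔ ∀ i, h i ∈ filt m := by
  simp [rowFilt, Submodule.mem_pi]

theorem rowFilt_mono : Monotone (rowFilt (d := d) k) := fun _ _ hmn _ hh =>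
  mem_rowFilt.2 fun i => filt_mono hmn (mem_rowFilt.1 hh i)

theorem exists_mem_rowFilt (h : Fin k → FA d) : ∃ m, h ∈ rowFilt k m := by
  choose m hm using fun i => exists_mem_filt (h i)
  exact ⟨Finset.univ.sup m, mem_rowFilt.2 fun i =>
    filt_mono (Finset.le_sup (Finset.mem_univ i)) (hm i)⟩

instance finiteDimensional_rowFilt (m : ℕ) : FiniteDimensional ℂ (rowFilt (d := d) k m) := by
  have := finiteDimensional_filt (d := d) m
  let f : rowFilt (d := d) k m →ₗ[ℂ] Fin k → filt (d := d) m :=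
    LinearMap.pi fun i => ((LinearMap.proj i).comp (rowFilt (d := d) k m).subtype).codRestrict
      (filt m) fun h => mem_rowFilt.1 h.2 i
  refine FiniteDimensional.of_injective f fun g h hgh => Subtype.ext (funext fun i => ?_)
  exact congrArg Subtype.val (congrFun hgh i)

end FreeAlgebra

section Realization

variable {d k : ℕ}

/-- The coefficients of a row with respect to the rows of `P` at the origin, where `B` is the
inverse of `P(0)`. -/
noncomputable def coeffZero (B : Matrix (Fin k) (Fin k) ℂ) : (Fin k → FA d) →ₗ[ℂ] (Fin k → ℂ) :=
  Matrix.vecMulLinear B ∘ₗ (aug (d := d)).toLinearMap.compLeft (Fin k)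

/-- The backward shift on rows, corrected so as to annihilate the rows of `P`. -/
noncomputable def rowShift (P : Matrix (Fin k) (Fin k) (FA d)) (B : Matrix (Fin k) (Fin k) ℂ)
    (j : Fin d) : Module.End ℂ (Fin k → FA d) :=
  (shift j).compLeft (Fin k) -
    ∑ i, (LinearMap.proj i ∘ₗ coeffZero B).smulRight ((shift j).compLeft (Fin k) (P i))

variable {P : Matrix (Fin k) (Fin k) (FA d)} {B : Matrix (Fin k) (Fin k) ℂ}

theorem coeffZero_apply (h : Fin k → FA d) (i : Fin k) :
    coeffZero B h i = ∑ c, aug (h c) * B c i := by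
  simp [coeffZero, Matrix.vecMul, dotProduct]

theorem rowShift_apply (j : Fin d) (h : Fin k → FA d) (c : Fin k) :
    rowShift P B j h c = shift j (h c) - ∑ i, coeffZero B h i • shift j (P i c) := by
  simp [rowShift, LinearMap.sum_apply]

theorem coeffZero_row (hB : P.map aug * B = 1) (i : Fin k) :
    coeffZero B (P i) = Pi.single i 1 := by
  ext c
  rw [coeffZero_apply]
  have := congrFun (congrFun hB i) c
  rw [Matrix.mul_apply] at this
  simp only [Matrix.map_apply] at this
  rw [this, Matrix.one_apply, Pi.single_apply]
  simp [eq_comm]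

theorem rowShift_row (hB : P.map aug * B = 1) (j : Fin d) (i : Fin k) :
    rowShift P B j (P i) = 0 := by
  ext c
  rw [rowShift_apply, coeffZero_row hB]
  simp [Pi.single_apply]

theorem sum_coeffZero_mul_aug (hB : P.map aug * B = 1) (h : Fin k → FA d) (c : Fin k) :
    ∑ i, coeffZero B h i * aug (P i c) = aug (h c) := by
  have hB' := mul_eq_one_comm.1 hB
  have h1 : coeffZero B h = Matrix.vecMul (fun i => aug (h i)) B := rfl
  have h2 : Matrix.vecMul (coeffZero B h) (P.map aug) = fun i => aug (h i) := by
    rw [h1, Matrix.vecMul_vecMul, hB', Matrix.vecMul_one]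
  exact congrFun h2 c

/-- The realization identity. -/
theorem eq_sum_row_add_sum_rowShift (hB : P.map aug * B = 1) (h : Fin k → FA d) :
    h = ∑ i, coeffZero B h i • P i + ∑ j, FreeAlgebra.ι ℂ j • rowShift P B j h := by
  ext c
  simp only [Pi.add_apply, Finset.sum_apply, Pi.smul_apply, smul_eq_mul, rowShift_apply]
  have h1 := eq_aug_add_sum_shift (h c - ∑ i, coeffZero B h i • P i c)
  have h2 : aug (h c - ∑ i, coeffZero B h i • P i c) = 0 := by
    rw [map_sub, map_sum]
    simp only [map_smul, smul_eq_mul]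
    rw [sum_coeffZero_mul_aug hB, sub_self]
  rw [h2, map_zero, zero_add, sub_eq_iff_eq_add'] at h1
  simpa only [map_sub, map_sum, map_smul] using h1

theorem coeffZero_ι_smul (i : Fin d) (g : Fin k → FA d) :
    coeffZero B (FreeAlgebra.ι ℂ i • g) = 0 := by
  ext c
  simp [coeffZero_apply, FreeAlgebra.algebraMapInv]

theorem rowShift_ι_smul (j i : Fin d) (g : Fin k → FA d) :
    rowShift P B j (FreeAlgebra.ι ℂ i • g) = if i = j then g else 0 := by
  ext c
  rw [rowShift_apply, coeffZero_ι_smul]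
  simp only [Pi.smul_apply, smul_eq_mul, shift_ι_mul, Pi.zero_apply, zero_smul,
    Finset.sum_const_zero, sub_zero]
  split_ifs <;> rfl

theorem rowShift_mem_rowFilt {m : ℕ} (hP : ∀ i, P i ∈ rowFilt k m) (j : Fin d)
    {h : Fin k → FA d} (hh : h ∈ rowFilt k m) : rowShift P B j h ∈ rowFilt k m := by
  refine mem_rowFilt.2 fun c => ?_
  rw [rowShift_apply]
  exact sub_mem (shift_mem_filt (mem_rowFilt.1 hh c) j) (sum_mem fun i _ =>
    Submodule.smul_mem _ _ (shift_mem_filt (mem_rowFilt.1 (hP i) c) j))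

theorem rowShift_single (j : Fin d) (c : Fin k) (a : FA d) :
    rowShift P B j (Pi.single c a) =
      Pi.single c (shift j a) + aug a • rowShift P B j (Pi.single c 1) := by
  ext b
  have h1 : ∀ (a : FA d) i, coeffZero B (Pi.single c a) i = aug a * B c i := by
    intro a i
    rw [coeffZero_apply, Finset.sum_eq_single c] <;> simp +contextual
  have h2 : shift j ((Pi.single c (1 : FA d) : Fin k → FA d) b) = 0 := by
    rcases eq_or_ne b c with rfl | hb
    · simp [shift_one]
    · simp [hb]
  have h3 : shift j ((Pi.single c a : Fin k → FA d) b) =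
      (Pi.single c (shift j a) : Fin k → FA d) b := by
    rcases eq_or_ne b c with rfl | hb
    · simp
    · simp [hb]
  rw [Pi.add_apply, Pi.smul_apply, rowShift_apply, rowShift_apply, h2, h3]
  simp only [h1, map_one, one_mul, zero_sub, smul_neg, Finset.smul_sum, smul_smul]
  rw [sub_eq_add_neg]

end Realization

section Generators

variable {d k : ℕ}

/-- A submodule of rows of free polynomials which, modulo `∑ j, Z_j N`, is spanned over `ℂ` by
`k` elements is generated by `k` elements. -/
theorem exists_generators (N : Submodule (FA d) (Fin k → FA d)) (p : Fin k → Fin k → FA d)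
    (hp : ∀ i, p i ∈ N) (hN : ∀ h ∈ N, ∃ (c : Fin k → ℂ) (f : Fin d → Fin k → FA d),
      (∀ j, f j ∈ N) ∧ h = ∑ i, c i • p i + ∑ j, FreeAlgebra.ι ℂ j • f j) :
    ∃ g : Fin k → Fin k → FA d, (∀ i, g i ∈ N) ∧ N ≤ Submodule.span (FA d) (Set.range g) := by
  classical
  let K : Submodule ℂ (Fin k → FA d) :=
    { carrier := {h | ∃ f : Fin d → Fin k → FA d, (∀ j, f j ∈ N) ∧
        h = ∑ j, FreeAlgebra.ι ℂ j • f j}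
      add_mem' := by
        rintro _ _ ⟨f, hf, rfl⟩ ⟨f', hf', rfl⟩
        exact ⟨f + f', fun j => add_mem (hf j) (hf' j), by
          simp [smul_add, Finset.sum_add_distrib]⟩
      zero_mem' := ⟨0, fun j => zero_mem _, by simp⟩
      smul_mem' := by
        rintro c _ ⟨f, hf, rfl⟩
        exact ⟨c • f, fun j => N.smul_of_tower_mem c (hf j), by
          rw [Finset.smul_sum]
          exact Finset.sum_congr rfl fun j _ => smul_comm _ _ _⟩ }
  let deg : (Fin k → FA d) → ℕ := fun h => Nat.find (exists_mem_rowFilt h)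
  have hdeg : ∀ h, h ∈ rowFilt k (deg h) := fun h => Nat.find_spec (exists_mem_rowFilt h)
  have hKf : ∀ f : Fin d → Fin k → FA d, (∀ j, f j ∈ N) → ∑ j, FreeAlgebra.ι ℂ j • f j ∈ K :=
    fun f hf => ⟨f, hf, rfl⟩
  have hKN : ∀ h ∈ K, ∀ m, h ∈ rowFilt k (m + 1) → ∃ f : Fin d → Fin k → FA d,
      (∀ j, f j ∈ N ∧ f j ∈ rowFilt k m) ∧ h = ∑ j, FreeAlgebra.ι ℂ j • f j := by
    rintro _ ⟨f, hf, rfl⟩ m hm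
    refine ⟨f, fun j => ⟨hf j, mem_rowFilt.2 fun c => ?_⟩, rfl⟩
    have := mem_filt_succ.1 (mem_rowFilt.1 hm c) j
    simpa [shift_ι_mul] using this
  let good : (Fin k → Fin k → FA d) → Prop := fun g => (∀ i, g i ∈ N) ∧
    ∀ h ∈ N, ∃ c : Fin k → ℂ, h - ∑ i, c i • g i ∈ K
  have hgood : ∃ s, ∃ g, good g ∧ ∑ i, deg (g i) = s := by
    refine ⟨_, p, ⟨hp, fun h hh => ?_⟩, rfl⟩
    obtain ⟨c, f, hf, rfl⟩ := hN h hh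
    exact ⟨c, by rw [add_sub_cancel_left]; exact hKf f hf⟩
  obtain ⟨g, hg, hs⟩ := Nat.find_spec hgood
  have hmin : ∀ g', good g' → ∑ i, deg (g i) ≤ ∑ i, deg (g' i) := fun g' hg' =>
    hs ▸ Nat.find_min' hgood ⟨g', hg', rfl⟩
  refine ⟨g, hg.1, ?_⟩
  have hle : ∀ h ∈ N, ∀ c : Fin k → ℂ, h - ∑ i, c i • g i ∈ K → ∀ i, c i ≠ 0 →
      deg (g i) ≤ deg h := by
    intro h hh c hc i hi
    by_contra! hlt
    refine (hmin (Function.update g i h) ⟨fun j => ?_, fun h' hh' => ?_⟩).not_gt ?_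
    · rcases eq_or_ne j i with rfl | hj
      · simpa using hh
      · simpa [hj] using hg.1 j
    · obtain ⟨a, ha⟩ := hg.2 h' hh'
      refine ⟨Function.update (a - (a i / c i) • c) i (a i / c i), ?_⟩
      have h1 : ∑ j, Function.update (a - (a i / c i) • c) i (a i / c i) j •
          Function.update g i h j = ∑ j, a j • g j - (a i / c i) • ∑ j, c j • g j +
            (a i / c i) • h := by
        rw [← Finset.add_sum_erase _ _ (Finset.mem_univ i), add_comm, Function.update_self,
          Function.update_self]
        congr 1
        rw [Finset.smul_sum, ← Finset.sum_sub_distrib,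
          ← Finset.add_sum_erase Finset.univ (fun j => a j • g j - (a i / c i) • c j • g j)
            (Finset.mem_univ i), smul_smul, div_mul_cancel₀ _ hi, sub_self, zero_add]
        refine Finset.sum_congr rfl fun j hj => ?_
        have hj := Finset.ne_of_mem_erase hj
        simp [hj, sub_smul, smul_smul]
      rw [h1]
      have h2 := sub_mem ha (K.smul_mem (a i / c i) hc)
      convert h2 using 1
      rw [smul_sub]
      abel
    · refine Finset.sum_lt_sum (fun j _ => ?_) ⟨i, Finset.mem_univ i, by simpa using hlt⟩
      rcases eq_or_ne j i with rfl | hj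
      · simpa using hlt.le
      · simp [hj]
  have key : ∀ m, ∀ h ∈ N, h ∈ rowFilt k m → h ∈ Submodule.span (FA d) (Set.range g) := by
    intro m
    induction m with
    | zero =>
      intro h _ hm
      have : h = 0 := funext fun c => mem_rowFilt.1 hm c
      rw [this]
      exact zero_mem _
    | succ m ih =>
      intro h hh hm
      obtain ⟨c, hc⟩ := hg.2 h hh
      have hsum : ∑ i, c i • g i ∈ rowFilt k (m + 1) := by
        refine sum_mem fun i _ => ?_
        rcases eq_or_ne (c i) 0 with h0 | h0
        · rw [h0, zero_smul]; exact zero_mem _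
        · exact Submodule.smul_mem _ _ (rowFilt_mono ((hle h hh c hc i h0).trans
            (Nat.find_min' (exists_mem_rowFilt h) hm)) (hdeg (g i)))
      obtain ⟨f, hf, hf'⟩ := hKN _ hc m (sub_mem hm hsum)
      rw [sub_eq_iff_eq_add] at hf'
      rw [hf']
      refine add_mem (sum_mem fun j _ => Submodule.smul_mem _ _ (ih _ (hf j).1 (hf j).2))
        (sum_mem fun i _ => ?_)
      rw [← algebraMap_smul (FA d) (c i) (g i)]
      exact Submodule.smul_mem _ _ (Submodule.subset_span ⟨i, rfl⟩)
  intro h hh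
  obtain ⟨m, hm⟩ := exists_mem_rowFilt h
  exact key m h hh hm

end Generators

section AtomDichotomy

variable {d k : ℕ} {P : Matrix (Fin k) (Fin k) (FA d)} {B : Matrix (Fin k) (Fin k) ℂ}

/-- The rows which are moved into `U` by all long words in the backward shifts. -/
noncomputable def absorber (P : Matrix (Fin k) (Fin k) (FA d)) (B : Matrix (Fin k) (Fin k) ℂ)
    (U : Submodule ℂ (Fin k → FA d)) : Submodule (FA d) (Fin k → FA d) where
  carrier := {h | ∃ m, ∀ w : List (Fin d), m ≤ w.length → (w.map (rowShift P B)).prod h ∈ U}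
  add_mem' := by
    rintro g h ⟨m, hm⟩ ⟨n, hn⟩
    refine ⟨max m n, fun w hw => ?_⟩
    rw [map_add]
    exact add_mem (hm w ((le_max_left _ _).trans hw)) (hn w ((le_max_right _ _).trans hw))
  zero_mem' := ⟨0, fun w _ => by rw [map_zero]; exact zero_mem _⟩
  smul_mem' := by
    intro a
    induction a using FreeAlgebra.induction with
    | grade0 c =>
      rintro h ⟨m, hm⟩
      refine ⟨m, fun w hw => ?_⟩
      rw [algebraMap_smul, map_smul]
      exact U.smul_mem _ (hm w hw)
    | grade1 i =>
      rintro h ⟨m, hm⟩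
      refine ⟨m + 1, fun w hw => ?_⟩
      obtain rfl | ⟨w, j, rfl⟩ := w.eq_nil_or_concat
      · simp at hw
      rw [List.concat_eq_append] at hw ⊢
      rw [List.length_append, List.length_singleton, Nat.add_le_add_iff_right] at hw
      rw [List.map_append, List.prod_append, Module.End.mul_apply, List.map_singleton,
        List.prod_singleton, rowShift_ι_smul]
      split_ifs
      · exact hm w hw
      · rw [map_zero]; exact zero_mem _
    | mul a b ha hb =>
      intro h hh
      rw [mul_smul]
      exact ha (hb hh)
    | add a b ha hb =>
      intro h hh
      obtain ⟨m, hm⟩ := ha hh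
      obtain ⟨n, hn⟩ := hb hh
      refine ⟨max m n, fun w hw => ?_⟩
      rw [add_smul, map_add]
      exact add_mem (hm w ((le_max_left _ _).trans hw)) (hn w ((le_max_right _ _).trans hw))

theorem rowShift_mem_absorber {U : Submodule ℂ (Fin k → FA d)} {h : Fin k → FA d}
    (hh : h ∈ absorber P B U) (j : Fin d) : rowShift P B j h ∈ absorber P B U := by
  obtain ⟨m, hm⟩ := hh
  refine ⟨m, fun w hw => ?_⟩
  simpa using hm (w ++ [j]) (by simp; omega)

theorem row_mem_absorber (hB : P.map aug * B = 1) (U : Submodule ℂ (Fin k → FA d)) (i : Fin k) :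
    P i ∈ absorber P B U := by
  refine ⟨1, fun w hw => ?_⟩
  obtain rfl | ⟨w, j, rfl⟩ := w.eq_nil_or_concat
  · simp at hw
  rw [List.concat_eq_append, List.map_append, List.prod_append, Module.End.mul_apply, List.map_singleton,
    List.prod_singleton, rowShift_row hB, map_zero]
  exact zero_mem _

theorem prod_mem_of_invariant {U : Submodule ℂ (Fin k → FA d)}
    (hU : ∀ j, ∀ h ∈ U, rowShift P B j h ∈ U) (w : List (Fin d)) {h : Fin k → FA d} (hh : h ∈ U) :
    (w.map (rowShift P B)).prod h ∈ U := by
  induction w with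
  | nil => simpa using hh
  | cons j w ih => simpa using hU j _ ih

/-- For finite-dimensional subspaces, the absorption time is uniform. -/
theorem exists_uniform_absorption {U A : Submodule ℂ (Fin k → FA d)} [FiniteDimensional ℂ A]
    (hA : ∀ h ∈ A, h ∈ absorber P B U) :
    ∃ m, ∀ w : List (Fin d), m ≤ w.length → ∀ h ∈ A, (w.map (rowShift P B)).prod h ∈ U := by
  obtain ⟨s, hs⟩ := (Submodule.fg_iff_finiteDimensional A).2 inferInstance
  choose! m hm using hA
  refine ⟨s.sup m, fun w hw h hh => ?_⟩
  have : A ≤ U.comap (w.map (rowShift P B)).prod := by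
    rw [← hs, Submodule.span_le]
    intro g hg
    exact hm g (hs ▸ Submodule.subset_span hg) w ((Finset.le_sup hg).trans hw)
  exact this hh

theorem nilpotent_or_absorbing (hP : IsAtomPoly P) (hB : P.map aug * B = 1)
    (U : Submodule ℂ (Fin k → FA d)) (hU : ∀ j, ∀ h ∈ U, rowShift P B j h ∈ U) :
    (∀ h ∈ U, h ∈ absorber P B ⊥) ∨ ∀ h, h ∈ absorber P B U := by
  obtain ⟨g, hg, hspan⟩ := exists_generators (absorber P B U) P (row_mem_absorber hB U)
    fun h hh => ⟨coeffZero B h, fun j => rowShift P B j h, rowShift_mem_absorber hh,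
      eq_sum_row_add_sum_rowShift hB h⟩
  choose H hH using fun i =>
    (Submodule.mem_span_range_iff_exists_fun _).1 (hspan (row_mem_absorber hB U i))
  have hfac : P = Matrix.of H * Matrix.of g := by
    ext i c
    rw [Matrix.mul_apply, ← hH i]
    simp
  rcases hP.2 _ _ hfac with hunit | hunit
  · left
    obtain ⟨u, hu⟩ := hunit
    have hg' : Matrix.of g = (↑u⁻¹ : Matrix (Fin k) (Fin k) (FA d)) * P := by
      rw [hfac, ← hu, ← mul_assoc, Units.inv_mul, one_mul]
    intro h hh
    have h1 : h ∈ Submodule.span (FA d) (Set.range g) :=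
      hspan ⟨0, fun w _ => prod_mem_of_invariant hU w hh⟩
    refine Submodule.span_le.2 ?_ h1
    rintro _ ⟨i, rfl⟩
    have h2 : g i = ∑ c, (↑u⁻¹ : Matrix (Fin k) (Fin k) (FA d)) i c • P c := by
      ext b
      have := congrFun (congrFun hg' i) b
      rw [Matrix.mul_apply] at this
      simpa using this
    rw [h2]
    exact sum_mem fun c _ => Submodule.smul_mem _ _ (row_mem_absorber hB ⊥ c)
  · right
    obtain ⟨u, hu⟩ := hunit
    intro h
    have h2 : h = ∑ i, (Matrix.vecMul h (↑u⁻¹ : Matrix (Fin k) (Fin k) (FA d))) i • g i := by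
      have h3 : Matrix.vecMul (Matrix.vecMul h (↑u⁻¹ : Matrix (Fin k) (Fin k) (FA d)))
          (Matrix.of g) = h := by
        rw [← hu, Matrix.vecMul_vecMul, Units.inv_mul, Matrix.vecMul_one]
      conv_lhs => rw [← h3]
      ext b
      simp [Matrix.vecMul, dotProduct]
    rw [h2]
    exact sum_mem fun c _ => Submodule.smul_mem _ _ (hg c)

theorem dichotomy_rowShift (hP : IsAtomPoly P) (hB : P.map aug * B = 1)
    (W : Submodule ℂ (Fin k → FA d)) [FiniteDimensional ℂ W]
    (hW : ∀ j, ∀ h ∈ W, rowShift P B j h ∈ W) :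
    Dichotomy (fun j => (rowShift P B j).restrict (hW j)) := by
  intro U hU
  have hint : ∀ (w : List (Fin d)) (h : W), (w.map (rowShift P B)).prod (W.subtype h) =
      W.subtype ((w.map fun j => (rowShift P B j).restrict (hW j)).prod h) :=
    prod_map_intertwine fun j h => rfl
  have hU' : ∀ j, ∀ h ∈ U.map W.subtype, rowShift P B j h ∈ U.map W.subtype := by
    rintro j _ ⟨h, hh, rfl⟩
    exact ⟨_, hU j h hh, rfl⟩
  rcases nilpotent_or_absorbing hP hB _ hU' with h | h
  · obtain ⟨m, hm⟩ := exists_uniform_absorption h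
    refine Or.inl ⟨m, fun w hw g hg => W.subtype_injective ?_⟩
    rw [← hint, map_zero]
    exact hm w hw.ge _ ⟨g, hg, rfl⟩
  · obtain ⟨m, hm⟩ := exists_uniform_absorption (A := W) fun g _ => h g
    refine Or.inr ⟨m, fun w hw g => ?_⟩
    obtain ⟨g', hg', he⟩ := hm w hw.ge _ g.2
    rw [← W.subtype_apply, hint] at he
    exact W.subtype_injective he ▸ hg'

end AtomDichotomy

section Evaluation

variable {d k l : ℕ} {E : Type} [NormedAddCommGroup E] [InnerProductSpace ℂ E]
  {Q : Fin d → Matrix (Fin l) (Fin l) ℂ}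
  {P : Matrix (Fin k) (Fin k) (FA d)} {B : Matrix (Fin k) (Fin k) ℂ}

/-- Evaluation of a row of free polynomials at `x`, applied to the column `v`. -/
noncomputable def evalRow (x : Fin d → E →L[ℂ] E) (v : Fin k → E) : (Fin k → FA d) →ₗ[ℂ] E where
  toFun h := ∑ c, FreeAlgebra.lift ℂ x (h c) (v c)
  map_add' g h := by simp [Finset.sum_add_distrib]
  map_smul' c h := by simp [Finset.smul_sum]

theorem evalRow_apply (x : Fin d → E →L[ℂ] E) (v : Fin k → E) (h : Fin k → FA d) :
    evalRow x v h = ∑ c, FreeAlgebra.lift ℂ x (h c) (v c) := rfl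

theorem evalRow_ι_smul (x : Fin d → E →L[ℂ] E) (v : Fin k → E) (j : Fin d) (h : Fin k → FA d) :
    evalRow x v (FreeAlgebra.ι ℂ j • h) = x j (evalRow x v h) := by
  simp [evalRow_apply]

theorem evalRow_single (x : Fin d → E →L[ℂ] E) (v : Fin k → E) (c : Fin k) (a : FA d) :
    evalRow x v (Pi.single c a) = FreeAlgebra.lift ℂ x a (v c) := by
  rw [evalRow_apply, Finset.sum_eq_single c] <;> simp +contextual

theorem lift_toEuclideanCLM {n : ℕ} (X : Fin d → Matrix (Fin n) (Fin n) ℂ) (a : FA d) :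
    FreeAlgebra.lift ℂ (fun j => Matrix.toEuclideanCLM (𝕜 := ℂ) (X j)) a =
      Matrix.toEuclideanCLM (𝕜 := ℂ) (ncEval X a) := by
  have : FreeAlgebra.lift ℂ (fun j => Matrix.toEuclideanCLM (𝕜 := ℂ) (X j)) =
      (Matrix.toEuclideanCLM (𝕜 := ℂ) (n := Fin n)).toAlgEquiv.toAlgHom.comp (ncEval X) := by
    ext j : 2
    simp [ncEval]
  exact DFunLike.congr_fun this a

/-- The blocks of a vector in `ℂ^k ⊗ ℂ^n`. -/
def block {n : ℕ} (z : Fin k × Fin n → ℂ) (c : Fin k) : EuclideanSpace ℂ (Fin n) :=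
  WithLp.toLp 2 fun q => z (c, q)

theorem block_mulVec {n : ℕ} (X : Fin d → Matrix (Fin n) (Fin n) ℂ) (z : Fin k × Fin n → ℂ)
    (i : Fin k) : block ((ncEvalM P X).mulVec z) i =
      evalRow (fun j => Matrix.toEuclideanCLM (𝕜 := ℂ) (X j)) (block z) (P i) := by
  ext p
  simp only [evalRow_apply, lift_toEuclideanCLM, WithLp.ofLp_sum, Finset.sum_apply]
  simp [block, ncEvalM, Matrix.mulVec, dotProduct, Fintype.sum_prod_type]

theorem Ball.conj {F : Type} [NormedAddCommGroup F] [InnerProductSpace ℂ F] [CompleteSpace E]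
    [CompleteSpace F] (e : E ≃ₗᵢ[ℂ] F) {x : Fin d → E →L[ℂ] E} (hx : Ball Q x) :
    Ball Q (fun j => e.conjStarAlgEquiv (x j)) := by
  obtain ⟨c, hc0, hc1, hc⟩ := hx
  refine ⟨c, hc0, hc1, fun z => ?_⟩
  have := hc fun b => e.symm (z b)
  simp only [LinearIsometryEquiv.norm_map] at this
  refine le_trans (le_of_eq (Finset.sum_congr rfl fun a _ => ?_)) this
  rw [← e.norm_map]
  simp [map_sum, map_smul]

theorem lift_conj {F : Type} [NormedAddCommGroup F] [InnerProductSpace ℂ F] [CompleteSpace E]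
    [CompleteSpace F] (e : E ≃ₗᵢ[ℂ] F) (x : Fin d → E →L[ℂ] E) (a : FA d) :
    FreeAlgebra.lift ℂ (fun j => e.conjStarAlgEquiv (x j)) a =
      e.conjStarAlgEquiv (FreeAlgebra.lift ℂ x a) := by
  have : FreeAlgebra.lift ℂ (fun j => e.conjStarAlgEquiv (x j)) =
      e.conjStarAlgEquiv.toAlgEquiv.toAlgHom.comp (FreeAlgebra.lift ℂ x) := by
    ext j : 2
    simp
  exact DFunLike.congr_fun this a

/-- Coordinate-free form of `Q`-stability. -/
theorem eq_zero_of_evalRow_eq_zero (hP : QStable Q P) [FiniteDimensional ℂ E]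
    {x : Fin d → E →L[ℂ] E} (hx : Ball Q x) {v : Fin k → E} (hv : ∀ i, evalRow x v (P i) = 0) :
    v = 0 := by
  rcases hn : Module.finrank ℂ E with _ | n
  · have := Module.finrank_zero_iff.1 hn
    exact Subsingleton.elim _ _
  let e : E ≃ₗᵢ[ℂ] EuclideanSpace ℂ (Fin (n + 1)) :=
    ((stdOrthonormalBasis ℂ E).reindex (finCongr hn)).repr
  let X : Fin d → Matrix (Fin (n + 1)) (Fin (n + 1)) ℂ := fun j =>
    (Matrix.toEuclideanCLM (𝕜 := ℂ)).symm (e.conjStarAlgEquiv (x j))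
  have hX : (fun j => Matrix.toEuclideanCLM (𝕜 := ℂ) (X j)) =
      fun j => e.conjStarAlgEquiv (x j) := by
    funext j
    exact StarAlgEquiv.apply_symm_apply _ _
  have hunit := hP n X ((memBallQ_iff_ball X).2 (by rw [hX]; exact hx.conj e))
  let z : Fin k × Fin (n + 1) → ℂ := fun p => e (v p.1) p.2
  have hz : block z = fun c => e (v c) := rfl
  have h0 : (ncEvalM P X).mulVec z = 0 := by
    have h1 : ∀ i, block ((ncEvalM P X).mulVec z) i = 0 := by
      intro i
      rw [block_mulVec, hX, hz, ← map_zero e, ← hv i, evalRow_apply, evalRow_apply, map_sum]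
      exact Finset.sum_congr rfl fun c _ => by rw [lift_conj]; simp
    ext ⟨i, p⟩
    exact congrFun (congrArg WithLp.ofLp (h1 i)) p
  have hz0 : z = 0 := Matrix.mulVec_injective_iff_isUnit.2 hunit (by rw [h0, Matrix.mulVec_zero])
  ext c
  refine e.injective ?_
  rw [Pi.zero_apply, map_zero]
  ext q
  exact congrFun hz0 (c, q)

theorem ball_zero : Ball Q (0 : Fin d → E →L[ℂ] E) :=
  ⟨0, le_rfl, one_pos, fun z => by simp⟩

theorem exists_inverse_aug (hP : QStable Q P) : ∃ B, P.map aug * B = 1 := by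
  have hinj : Function.Injective (P.map aug).mulVec := by
    rw [← Matrix.coe_mulVecLin, injective_iff_map_eq_zero]
    intro v hv
    refine eq_zero_of_evalRow_eq_zero hP (E := ℂ) ball_zero fun i => ?_
    have hl : ∀ a : FA d, FreeAlgebra.lift ℂ (0 : Fin d → ℂ →L[ℂ] ℂ) a =
        algebraMap ℂ (ℂ →L[ℂ] ℂ) (aug a) := by
      intro a
      have : FreeAlgebra.lift ℂ (0 : Fin d → ℂ →L[ℂ] ℂ) =
          (Algebra.ofId ℂ (ℂ →L[ℂ] ℂ)).comp aug := by
        ext j : 2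
        simp [FreeAlgebra.algebraMapInv]
      exact DFunLike.congr_fun this a
    have := congrFun hv i
    simpa [Matrix.mulVec, dotProduct, evalRow_apply, hl, Algebra.algebraMap_eq_smul_one] using this
  obtain ⟨u, hu⟩ := Matrix.mulVec_injective_iff_isUnit.1 hinj
  exact ⟨↑u⁻¹, by rw [← hu, Units.mul_inv]⟩

theorem stable_rowShift (hP : QStable Q P) (hB : P.map aug * B = 1) {D : ℕ}
    (hPD : ∀ i, P i ∈ rowFilt k D) :
    Stable Q (fun j => (rowShift P B j).restrict fun _ hh => rowShift_mem_rowFilt hPD j hh) := by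
  intro E _ _ _ x hx η hη
  obtain ⟨θ, rfl⟩ := LinearMap.exists_extend η
  have hθ : ∀ h ∈ rowFilt k D, θ h = ∑ j, x j (θ (rowShift P B j h)) := by
    intro h hh
    have := LinearMap.congr_fun hη ⟨h, hh⟩
    rw [pencil_apply] at this
    exact this.symm
  have hsingle : ∀ m ≤ D, ∀ a ∈ filt m, ∀ c,
      θ (Pi.single c a) = FreeAlgebra.lift ℂ x a (θ (Pi.single c 1)) := by
    intro m
    induction m with
    | zero =>
      intro _ a ha c
      rw [show a = 0 from ha]
      simp
    | succ m ih =>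
      intro hm a ha c
      have hmem : ∀ b ∈ filt D, Pi.single c b ∈ rowFilt (d := d) k D := by
        intro b hb
        refine mem_rowFilt.2 fun i => ?_
        rcases eq_or_ne i c with rfl | hi
        · simpa using hb
        · simp [hi]
      have h1 : (1 : FA d) ∈ filt D :=
        filt_mono (by omega) (map_one (algebraMap ℂ (FA d)) ▸ algebraMap_mem_filt (d := d) 1)
      have h2 := hθ _ (hmem a (filt_mono hm ha))
      simp only [rowShift_single _ _ a, map_add, map_smul, Finset.sum_add_distrib,
        ← Finset.smul_sum, ← hθ _ (hmem 1 h1)] at h2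
      rw [h2]
      conv_rhs => rw [eq_aug_add_sum_shift a]
      rw [map_add, add_apply, map_sum, sum_apply,
        AlgHom.commutes, add_comm, Algebra.algebraMap_eq_smul_one, smul_apply]
      congr 1
      refine Finset.sum_congr rfl fun j _ => ?_
      rw [ih (by omega) _ (mem_filt_succ.1 ha j), map_mul, FreeAlgebra.lift_ι_apply]
      rfl
  have heval : ∀ h ∈ rowFilt k D, θ h = evalRow x (fun c => θ (Pi.single c 1)) h := by
    intro h hh
    conv_lhs => rw [← Finset.univ_sum_single h, map_sum]
    exact Finset.sum_congr rfl fun c _ => hsingle D le_rfl _ (mem_rowFilt.1 hh c) c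
  have hv := eq_zero_of_evalRow_eq_zero hP hx (v := fun c => θ (Pi.single c 1)) fun i => by
    rw [← heval _ (hPD i), hθ _ (hPD i)]
    simp [rowShift_row hB]
  ext h
  have := heval h h.2
  rw [hv] at this
  simpa [evalRow_apply] using this

/-- Simple growth of the inverse of a stable atom at the boundary of the operator ball. -/
theorem exists_norm_le_of_atom (hQ : LinearIndependent ℂ Q) (hP : QStable Q P)
    (hA : IsAtomPoly P) : ∃ C : ℝ, 0 ≤ C ∧ ∀ (E : Type) [NormedAddCommGroup E]
      [InnerProductSpace ℂ E] [FiniteDimensional ℂ E] (x : Fin d → E →L[ℂ] E), Ball Q x →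
      ∀ r : ℝ, 0 ≤ r → r < 1 → ∀ (v : Fin k → E) (c : Fin k),
        ‖v c‖ ≤ C / (1 - r) * ∑ i, ‖evalRow (fun j => (r : ℂ) • x j) v (P i)‖ := by
  obtain ⟨B, hB⟩ := exists_inverse_aug hP
  choose m hm using fun i => exists_mem_rowFilt (P i)
  set D := Finset.univ.sup m + 1 with hD
  have hPD : ∀ i, P i ∈ rowFilt k D := fun i =>
    rowFilt_mono ((Finset.le_sup (Finset.mem_univ i)).trans (Nat.le_succ _)) (hm i)
  have hres := resolventBound_of_dichotomy hQ _ (rowFilt k D) _ rfl (stable_rowShift hP hB hPD)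
    (dichotomy_rowShift hA hB _ fun j _ hh => rowShift_mem_rowFilt hPD j hh)
  have hmem : ∀ c : Fin k, (Pi.single c 1 : Fin k → FA d) ∈ rowFilt k D := by
    intro c
    refine mem_rowFilt.2 fun i => ?_
    rcases eq_or_ne i c with rfl | hi
    · rw [Pi.single_eq_same, ← map_one (algebraMap ℂ (FA d))]
      exact filt_mono (by omega) (algebraMap_mem_filt 1)
    · simp [hi]
  choose C hC0 hC using fun c => hres ⟨_, hmem c⟩
  let b := Module.finBasis ℂ (rowFilt (d := d) k D)
  set K : ℝ := ∑ a, ∑ i, ‖coeffZero B (b a : Fin k → FA d) i‖ with hK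
  have hK0 : 0 ≤ K := Finset.sum_nonneg fun a _ => Finset.sum_nonneg fun i _ => norm_nonneg _
  refine ⟨(∑ c, C c) * K, mul_nonneg (Finset.sum_nonneg fun c _ => hC0 c) hK0,
    fun E _ _ _ x hx r hr0 hr1 v c => ?_⟩
  set s : ℝ := ∑ i, ‖evalRow (fun j => (r : ℂ) • x j) v (P i)‖ with hs
  have hs0 : 0 ≤ s := Finset.sum_nonneg fun i _ => norm_nonneg _
  let η := evalRow (fun j => (r : ℂ) • x j) v
  let y : (Fin k → FA d) →ₗ[ℂ] E :=
    ∑ i, (LinearMap.proj i ∘ₗ coeffZero B).smulRight (η (P i))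
  have hy : ∀ h, y h = ∑ i, coeffZero B h i • η (P i) := fun h => by
    simp [y, LinearMap.sum_apply]
  have hrec : η ∘ₗ (rowFilt (d := d) k D).subtype =
      (r : ℂ) • pencil (fun j => (rowShift P B j).restrict
        fun _ hh => rowShift_mem_rowFilt hPD j hh) x (η ∘ₗ (rowFilt (d := d) k D).subtype) +
      y ∘ₗ (rowFilt (d := d) k D).subtype := by
    ext h
    rw [LinearMap.add_apply, LinearMap.smul_apply, pencil_apply]
    change η h = (r : ℂ) • ∑ j, x j (η (rowShift P B j h)) + y h
    conv_lhs => rw [eq_sum_row_add_sum_rowShift hB (h : Fin k → FA d)]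
    rw [map_add, map_sum, map_sum, hy, add_comm, Finset.smul_sum]
    congr 1
    · exact Finset.sum_congr rfl fun j _ => evalRow_ι_smul _ _ _ _
    · exact Finset.sum_congr rfl fun j _ => map_smul _ _ _
  have hbound : ∀ a, ‖(y ∘ₗ (rowFilt (d := d) k D).subtype) (b a)‖ ≤ K * s := by
    intro a
    rw [LinearMap.comp_apply, hy]
    have h1 : ∑ i, ‖coeffZero B (b a : Fin k → FA d) i‖ ≤ K :=
      Finset.single_le_sum (f := fun a => ∑ i, ‖coeffZero B (b a : Fin k → FA d) i‖)
        (fun a _ => Finset.sum_nonneg fun i _ => norm_nonneg _) (Finset.mem_univ a)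
    refine (norm_sum_le _ _).trans (le_trans ?_ (mul_le_mul_of_nonneg_right h1 hs0))
    rw [Finset.sum_mul]
    refine Finset.sum_le_sum fun i _ => ?_
    rw [norm_smul]
    exact mul_le_mul_of_nonneg_left (Finset.single_le_sum
      (f := fun i => ‖η (P i)‖) (fun i _ => norm_nonneg _) (Finset.mem_univ i)) (norm_nonneg _)
  have key := hC c E x hx r hr0 hr1 _ _ hrec _ hbound
  have hval : (η ∘ₗ (rowFilt (d := d) k D).subtype) ⟨_, hmem c⟩ = v c := by
    change evalRow (fun j => (r : ℂ) • x j) v (Pi.single c 1) = v c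
    rw [evalRow_single]
    simp
  rw [hval] at key
  refine key.trans ?_
  rw [← mul_assoc, div_mul_eq_mul_div]
  refine mul_le_mul_of_nonneg_right ?_ hs0
  refine div_le_div_of_nonneg_right (mul_le_mul_of_nonneg_right ?_ hK0) (by linarith)
  exact Finset.single_le_sum (fun c _ => hC0 c) (Finset.mem_univ c)

end Evaluation

section Assembly

variable {d k n : ℕ}

theorem ncEvalM_mul (F G : Matrix (Fin k) (Fin k) (FA d)) (X : Fin d → Matrix (Fin n) (Fin n) ℂ) :
    ncEvalM (F * G) X = ncEvalM F X * ncEvalM G X := by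
  ext ⟨i, p⟩ ⟨j, q⟩
  simp [ncEvalM, Matrix.mul_apply, Matrix.sum_apply, Fintype.sum_prod_type]

theorem ncEvalM_one (X : Fin d → Matrix (Fin n) (Fin n) ℂ) :
    ncEvalM (1 : Matrix (Fin k) (Fin k) (FA d)) X = 1 := by
  ext ⟨i, p⟩ ⟨j, q⟩
  rcases eq_or_ne i j with rfl | h
  · simp [ncEvalM, Matrix.one_apply]
  · simp [ncEvalM, h]

theorem ncEvalM_list_prod (L : List (Matrix (Fin k) (Fin k) (FA d)))
    (X : Fin d → Matrix (Fin n) (Fin n) ℂ) :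
    ncEvalM L.prod X = (L.map fun F => ncEvalM F X).prod := by
  induction L with
  | nil => exact ncEvalM_one X
  | cons F L ih => rw [List.prod_cons, ncEvalM_mul, ih, List.map_cons, List.prod_cons]

theorem isUnit_of_isUnit_list_prod {m : Type*} [Fintype m] [DecidableEq m]
    {L : List (Matrix m m ℂ)} (hL : IsUnit L.prod) {M : Matrix m m ℂ} (hM : M ∈ L) : IsUnit M := by
  rw [Matrix.isUnit_iff_isUnit_det] at hL ⊢
  rw [← Matrix.coe_detMonoidHom, map_list_prod] at hL
  exact isUnit_of_dvd_unit (List.dvd_prod (List.mem_map_of_mem hM)) hL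

theorem opNorm_list_prod_le {ι m : Type*} [Fintype m] [DecidableEq m] (L : List ι)
    {f : ι → Matrix m m ℂ} {C : ι → ℝ} (h : ∀ i, opNorm (f i) ≤ C i) :
    opNorm (L.map f).prod ≤ (L.map C).prod := by
  induction L with
  | nil =>
    rw [opNorm, List.map_nil, List.prod_nil, map_one]
    exact ContinuousLinearMap.norm_id_le
  | cons i L ih =>
    rw [List.map_cons, List.prod_cons, List.map_cons, List.prod_cons, opNorm, map_mul]
    exact (norm_mul_le _ _).trans
      (mul_le_mul (h i) ih (norm_nonneg _) ((norm_nonneg _).trans (h i)))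

theorem opNorm_one_add_mul_le {m : Type*} [Fintype m] [DecidableEq m] {M N : Matrix m m ℂ}
    {a b K : ℝ} (hM : opNorm M ≤ a) (hN : opNorm N ≤ b) (hab : a * b ≤ K) :
    opNorm (1 + M * N) ≤ 1 + K := by
  rw [opNorm, map_add, map_one, map_mul]
  refine (norm_add_le _ _).trans ?_
  refine add_le_add ContinuousLinearMap.norm_id_le ?_
  exact (norm_mul_le _ _).trans
    ((mul_le_mul hM hN (norm_nonneg _) ((norm_nonneg _).trans hM)).trans hab)

theorem norm_sq_eq_sum_block (z : Fin k × Fin n → ℂ) :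
    ‖(WithLp.toLp 2 z : EuclideanSpace ℂ (Fin k × Fin n))‖ ^ 2 = ∑ c, ‖block z c‖ ^ 2 := by
  simp only [EuclideanSpace.norm_sq_eq, Fintype.sum_prod_type, block]

theorem norm_block_le (z : Fin k × Fin n → ℂ) (c : Fin k) :
    ‖block z c‖ ≤ ‖(WithLp.toLp 2 z : EuclideanSpace ℂ (Fin k × Fin n))‖ := by
  refine le_of_sq_le_sq ?_ (norm_nonneg _)
  rw [norm_sq_eq_sum_block]
  exact Finset.single_le_sum (f := fun c => ‖block z c‖ ^ 2) (fun _ _ => by positivity)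
    (Finset.mem_univ c)

theorem norm_le_sum_block (z : Fin k × Fin n → ℂ) :
    ‖(WithLp.toLp 2 z : EuclideanSpace ℂ (Fin k × Fin n))‖ ≤ ∑ c, ‖block z c‖ := by
  refine le_of_sq_le_sq ?_ (Finset.sum_nonneg fun _ _ => norm_nonneg _)
  rw [norm_sq_eq_sum_block]
  exact Finset.sum_sq_le_sq_sum_of_nonneg fun _ _ => norm_nonneg _

theorem opNorm_le_of_block {M : Matrix (Fin k × Fin n) (Fin k × Fin n) ℂ} {K : ℝ} (hK : 0 ≤ K)
    (h : ∀ z i, ‖block (M.mulVec z) i‖ ≤ K * ∑ c, ‖block z c‖) : opNorm M ≤ k ^ 2 * K := by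
  refine ContinuousLinearMap.opNorm_le_bound _ (by positivity) fun x => ?_
  calc ‖Matrix.toEuclideanCLM (𝕜 := ℂ) M x‖ ≤ ∑ i, ‖block (M.mulVec x.ofLp) i‖ :=
        norm_le_sum_block _
    _ ≤ ∑ _i : Fin k, K * ∑ _c : Fin k, ‖x‖ :=
        Finset.sum_le_sum fun i _ => (h _ i).trans
          (mul_le_mul_of_nonneg_left (Finset.sum_le_sum fun c _ => norm_block_le _ c) hK)
    _ = k ^ 2 * K * ‖x‖ := by
        simp only [Finset.sum_const, Finset.card_univ, Fintype.card_fin, nsmul_eq_mul]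
        ring

variable {l : ℕ} {Q : Fin d → Matrix (Fin l) (Fin l) ℂ}

/-- Free polynomials are bounded and radially Lipschitz on the operator ball. -/
theorem exists_norm_lift_le (hQ : LinearIndependent ℂ Q) (a : FA d) : ∃ C : ℝ, 0 ≤ C ∧
    ∀ (E : Type) [NormedAddCommGroup E] [InnerProductSpace ℂ E] (x : Fin d → E →L[ℂ] E), Ball Q x →
      (∀ v, ‖FreeAlgebra.lift ℂ x a v‖ ≤ C * ‖v‖) ∧ ∀ r : ℝ, 0 ≤ r → r < 1 → ∀ v,
        ‖FreeAlgebra.lift ℂ x a v - FreeAlgebra.lift ℂ (fun j => (r : ℂ) • x j) a v‖ ≤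
          C * (1 - r) * ‖v‖ := by
  induction a using FreeAlgebra.induction with
  | grade0 c =>
    refine ⟨‖c‖, norm_nonneg _, fun E _ _ x _ => ⟨fun v => ?_, fun r _ hr1 v => ?_⟩⟩
    · rw [AlgHom.commutes, Algebra.algebraMap_eq_smul_one, smul_apply, norm_smul]
      rfl
    · rw [AlgHom.commutes, AlgHom.commutes, sub_self, norm_zero]
      have : 0 ≤ 1 - r := by linarith
      positivity
  | grade1 j =>
    obtain ⟨K, hK0, hK⟩ := Ball.norm_le hQ
    refine ⟨K, hK0, fun E _ _ x hx => ⟨fun v => ?_, fun r _ hr1 v => ?_⟩⟩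
    · rw [FreeAlgebra.lift_ι_apply]
      exact hK E x hx j v
    · rw [FreeAlgebra.lift_ι_apply, FreeAlgebra.lift_ι_apply, smul_apply]
      have h1 : x j v - (r : ℂ) • x j v = ((1 - r : ℝ) : ℂ) • x j v := by
        push_cast
        rw [sub_smul, one_smul]
      rw [h1, norm_smul, Complex.norm_real, Real.norm_of_nonneg (by linarith), mul_right_comm,
        mul_comm]
      exact mul_le_mul_of_nonneg_right (hK E x hx j v) (by linarith)
  | mul a b ha hb =>
    obtain ⟨A, hA0, hA⟩ := ha
    obtain ⟨B, hB0, hB⟩ := hb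
    refine ⟨2 * (A * B), by positivity, fun E _ _ x hx => ⟨fun v => ?_, fun r hr0 hr1 v => ?_⟩⟩
    · rw [map_mul, mul_apply_eq_comp]
      calc _ ≤ A * (B * ‖v‖) := ((hA E x hx).1 _).trans
            (mul_le_mul_of_nonneg_left ((hB E x hx).1 v) hA0)
        _ ≤ _ := by
            have : 0 ≤ A * (B * ‖v‖) := by positivity
            linarith
    · have hrx : Ball Q fun j => (r : ℂ) • x j := hx.smul (by
        rw [Complex.norm_real, Real.norm_of_nonneg hr0]; exact hr1.le)
      have hr : 0 ≤ 1 - r := by linarith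
      rw [map_mul, map_mul, mul_apply_eq_comp, mul_apply_eq_comp]
      set y := fun j => (r : ℂ) • x j
      set w := FreeAlgebra.lift ℂ y b v
      rw [← sub_add_sub_cancel _ (FreeAlgebra.lift ℂ x a w), ← map_sub]
      have h1 : A * ‖FreeAlgebra.lift ℂ x b v - w‖ ≤ A * (B * (1 - r) * ‖v‖) :=
        mul_le_mul_of_nonneg_left ((hB E x hx).2 r hr0 hr1 v) hA0
      have h2 : A * (1 - r) * ‖w‖ ≤ A * (1 - r) * (B * ‖v‖) :=
        mul_le_mul_of_nonneg_left ((hB E y hrx).1 v) (by positivity)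
      have h3 := (hA E x hx).1 (FreeAlgebra.lift ℂ x b v - w)
      have h4 := (hA E x hx).2 r hr0 hr1 w
      refine (norm_add_le _ _).trans ?_
      linarith
  | add a b ha hb =>
    obtain ⟨A, hA0, hA⟩ := ha
    obtain ⟨B, hB0, hB⟩ := hb
    refine ⟨A + B, by positivity, fun E _ _ x hx => ⟨fun v => ?_, fun r hr0 hr1 v => ?_⟩⟩
    · rw [map_add, add_apply, add_mul]
      exact (norm_add_le _ _).trans (add_le_add ((hA E x hx).1 v) ((hB E x hx).1 v))
    · rw [map_add, map_add, add_apply, add_apply, add_sub_add_comm, add_mul, add_mul]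
      exact (norm_add_le _ _).trans
        (add_le_add ((hA E x hx).2 r hr0 hr1 v) ((hB E x hx).2 r hr0 hr1 v))

variable {P : Matrix (Fin k) (Fin k) (FA d)}

theorem memBallQ_smul {X : Fin d → Matrix (Fin n) (Fin n) ℂ} (hX : memBallQ Q X) {r : ℝ}
    (hr0 : 0 ≤ r) (hr1 : r < 1) : memBallQ Q fun j => (r : ℂ) • X j := by
  rw [memBallQ_iff_ball] at hX ⊢
  simp only [map_smul]
  exact hX.smul (by rw [Complex.norm_real, Real.norm_of_nonneg hr0]; exact hr1.le)

theorem exists_opNorm_sub_le (hQ : LinearIndependent ℂ Q) (P : Matrix (Fin k) (Fin k) (FA d)) :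
    ∃ C : ℝ, 0 ≤ C ∧ ∀ r : ℝ, 0 ≤ r → r < 1 →
      ∀ (n : ℕ) (X : Fin d → Matrix (Fin n) (Fin n) ℂ), memBallQ Q X →
        opNorm (ncEvalM P X - ncEvalM P fun j => (r : ℂ) • X j) ≤ C * (1 - r) := by
  choose C hC0 hC using fun i c => exists_norm_lift_le hQ (P i c)
  have hS0 : 0 ≤ ∑ i, ∑ c, C i c := Finset.sum_nonneg fun i _ => Finset.sum_nonneg fun c _ => hC0 i c
  refine ⟨k ^ 2 * ∑ i, ∑ c, C i c, by positivity, fun r hr0 hr1 n X hX => ?_⟩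
  have hr : 0 ≤ 1 - r := by linarith
  rw [mul_assoc]
  refine opNorm_le_of_block (by positivity) fun z i => ?_
  have hsub : block ((ncEvalM P X - ncEvalM P fun j => (r : ℂ) • X j).mulVec z) i =
      block ((ncEvalM P X).mulVec z) i -
        block ((ncEvalM P fun j => (r : ℂ) • X j).mulVec z) i := by
    rw [Matrix.sub_mulVec]
    rfl
  rw [hsub, block_mulVec, block_mulVec, evalRow_apply, evalRow_apply, ← Finset.sum_sub_distrib,
    Finset.mul_sum]
  simp only [map_smul]
  refine (norm_sum_le _ _).trans (Finset.sum_le_sum fun c _ => ?_)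
  refine ((hC i c _ _ ((memBallQ_iff_ball X).1 hX)).2 r hr0 hr1 _).trans ?_
  refine mul_le_mul_of_nonneg_right (mul_le_mul_of_nonneg_right ?_ hr) (norm_nonneg _)
  exact (Finset.single_le_sum (f := fun c => C i c) (fun c _ => hC0 i c) (Finset.mem_univ c)).trans
    (Finset.single_le_sum (f := fun i => ∑ c, C i c)
      (fun i _ => Finset.sum_nonneg fun c _ => hC0 i c) (Finset.mem_univ i))

theorem exists_opNorm_inv_le (hQ : LinearIndependent ℂ Q) (hP : QStable Q P) (hA : IsAtomPoly P) :
    ∃ C : ℝ, 0 ≤ C ∧ ∀ r : ℝ, 0 ≤ r → r < 1 →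
      ∀ (n : ℕ) (X : Fin d → Matrix (Fin (n + 1)) (Fin (n + 1)) ℂ), memBallQ Q X →
        opNorm (ncEvalM P fun j => (r : ℂ) • X j)⁻¹ ≤ C / (1 - r) := by
  obtain ⟨C, hC0, hC⟩ := exists_norm_le_of_atom hQ hP hA
  refine ⟨k ^ 2 * C, by positivity, fun r hr0 hr1 n X hX => ?_⟩
  have hr : 0 ≤ 1 - r := by linarith
  have hdet := (Matrix.isUnit_iff_isUnit_det _).1 (hP n _ (memBallQ_smul hX hr0 hr1))
  rw [mul_div_assoc]
  refine opNorm_le_of_block (by positivity) fun z c => ?_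
  refine (hC _ _ ((memBallQ_iff_ball X).1 hX) r hr0 hr1 _ c).trans (le_of_eq ?_)
  congr 1
  refine Finset.sum_congr rfl fun i _ => ?_
  have := block_mulVec (P := P) (fun j => (r : ℂ) • X j)
    ((ncEvalM P fun j => (r : ℂ) • X j)⁻¹.mulVec z) i
  rw [Matrix.mulVec_mulVec, Matrix.mul_nonsing_inv _ hdet, Matrix.one_mulVec] at this
  rw [this]
  simp only [map_smul]

/-- The NGN inequality for a single stable atom. -/
theorem exists_opNorm_inv_mul_le (hQ : LinearIndependent ℂ Q) (hP : QStable Q P)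
    (hA : IsAtomPoly P) :
    ∃ C : ℝ, ∀ r : ℝ, 0 ≤ r → r < 1 →
      ∀ (n : ℕ) (X : Fin d → Matrix (Fin (n + 1)) (Fin (n + 1)) ℂ), memBallQ Q X →
        opNorm ((ncEvalM P fun j => (r : ℂ) • X j)⁻¹ * ncEvalM P X) ≤ C ∧
        opNorm (ncEvalM P X * (ncEvalM P fun j => (r : ℂ) • X j)⁻¹) ≤ C := by
  obtain ⟨C, hC0, hC⟩ := exists_opNorm_inv_le hQ hP hA
  obtain ⟨K, hK0, hK⟩ := exists_opNorm_sub_le hQ P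
  refine ⟨1 + C * K, fun r hr0 hr1 n X hX => ?_⟩
  have hr : 1 - r ≠ 0 := by linarith
  have hdet := (Matrix.isUnit_iff_isUnit_det _).1 (hP n _ (memBallQ_smul hX hr0 hr1))
  have h1 := hC r hr0 hr1 n X hX
  have h2 := hK r hr0 hr1 (n + 1) X hX
  constructor
  · have := opNorm_one_add_mul_le h1 h2 (K := C * K) (le_of_eq (by field_simp))
    rwa [Matrix.mul_sub, Matrix.nonsing_inv_mul _ hdet, add_sub_cancel] at this
  · have := opNorm_one_add_mul_le h2 h1 (K := C * K) (le_of_eq (by field_simp))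
    rwa [Matrix.sub_mul, Matrix.mul_nonsing_inv _ hdet, add_sub_cancel] at this

end Assembly

end NGN

/-- **Corollary (NGN inequality for general `Q`-stable matrix free polynomials).**
If `P = P₁⋯P_m` is `Q`-stable with each `P_i` an atom, then each `P_i` is
`Q`-stable and the interleaved NGN products
`P₁(rX)⁻¹P₁(X)⋯P_m(rX)⁻¹P_m(X)` and `P₁(X)P₁(rX)⁻¹⋯P_m(X)P_m(rX)⁻¹`
are uniformly bounded in norm over `r ∈ [0,1)` and `X ∈ 𝔻_Q`. -/
theorem ngn_Q_stable_general {d k l m : ℕ} (hd : 0 < d) (hk : 0 < k) (hl : 0 < l)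
    (hm : 0 < m)
    (Q : Fin d → Matrix (Fin l) (Fin l) ℂ) (hQ : LinearIndependent ℂ Q)
    (P : Matrix (Fin k) (Fin k) (FreeAlgebra ℂ (Fin d)))
    (Ps : Fin m → Matrix (Fin k) (Fin k) (FreeAlgebra ℂ (Fin d)))
    (hfact : P = (List.ofFn Ps).prod)
    (hatoms : ∀ i, IsAtomPoly (Ps i))
    (hstable : QStable Q P) :
    (∀ i, QStable Q (Ps i)) ∧
    ∃ C : ℝ, ∀ (r : ℝ), 0 ≤ r → r < 1 →
      ∀ (n : ℕ) (X : Fin d → Matrix (Fin (n + 1)) (Fin (n + 1)) ℂ), memBallQ Q X →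
        opNorm ((List.ofFn fun i =>
            (ncEvalM (Ps i) (fun j => (r : ℂ) • X j))⁻¹ * ncEvalM (Ps i) X).prod) ≤ C ∧
        opNorm ((List.ofFn fun i =>
            ncEvalM (Ps i) X * (ncEvalM (Ps i) (fun j => (r : ℂ) • X j))⁻¹).prod) ≤ C := by
  have hst : ∀ i, QStable Q (Ps i) := by
    intro i n X hX
    have h := hstable n X hX
    rw [hfact, NGN.ncEvalM_list_prod] at h
    exact NGN.isUnit_of_isUnit_list_prod h
      (List.mem_map_of_mem (f := fun F => ncEvalM F X) (List.mem_ofFn.2 ⟨i, rfl⟩))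
  refine ⟨hst, ?_⟩
  choose C hC using fun i => NGN.exists_opNorm_inv_mul_le hQ (hst i) (hatoms i)
  refine ⟨((List.finRange m).map C).prod, fun r hr0 hr1 n X hX => ?_⟩
  rw [List.ofFn_eq_map, List.ofFn_eq_map]
  exact ⟨NGN.opNorm_list_prod_le _ fun i => (hC i r hr0 hr1 n X hX).1,
    NGN.opNorm_list_prod_le _ fun i => (hC i r hr0 hr1 n X hX).2⟩
end

section
/- Proposition (improved NGN bounds via uni-triangular linearization): Let P ∈ ℂ⟨Z⟩ be a Q-stable (scalar) free polynomial with homogeneous expansion P = ∑_{j=0}^N P_j. Suppose there exist m ≥ 1, a d-tuple A = (A₁,…,A_d) of m×m complex matrices with monic pencil L_A = I_m − ∑_j A_j Z_j, integers l₁, l₂ with 1 + l₁ = m + l₂ =: e, an upper uni-triangular U ∈ M_e(ℂ⟨Z⟩) and a lower uni-triangular V ∈ M_e(ℂ⟨Z⟩) such that diag(P, I_{l₁}) = U · diag(L_A, I_{l₂}) · V in M_e(ℂ⟨Z⟩), and an invertible S ∈ M_m(ℂ) such that the tuple B := S⁻¹AS (i.e., B_j = S⁻¹A_jS) satisfies ‖∑_{j=1}^d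 B_j ⊗ X_j‖ ≤ 1 for every n ≥ 1 and every X ∈ 𝔻_Q(n). Then, with κ(S) := ‖S‖·‖S⁻¹‖, for every r ∈ [0,1), every n ≥ 1 and every X ∈ 𝔻_Q(n) the matrix P(rX) is invertible and both ‖P(X)·P(rX)⁻¹‖ ≤ 1 + κ(S)·∑_{j=1}^N j‖P_j‖_Q and ‖P(rX)⁻¹·P(X)‖ ≤ 1 + κ(S)·∑_{j=1}^N j‖P_j‖_Q, the inequalities understood in [0,∞]. -/
open scoped Kronecker ENNReal

open scoped Matrix.Norms.L2Operator in
theorem opNorm_eq_l2_norm {m : Type*} [Fintype m] [DecidableEq m] (M : Matrix m m ℂ) :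
    opNorm M = ‖M‖ := rfl

theorem opNorm_nonneg {m : Type*} [Fintype m] [DecidableEq m] (M : Matrix m m ℂ) :
    0 ≤ opNorm M := norm_nonneg _

theorem opNorm_one_le {m : Type*} [Fintype m] [DecidableEq m] :
    opNorm (1 : Matrix m m ℂ) ≤ 1 := by
  rw [opNorm, map_one]
  exact ContinuousLinearMap.norm_id_le

theorem opNorm_add_le {m : Type*} [Fintype m] [DecidableEq m] (M M' : Matrix m m ℂ) :
    opNorm (M + M') ≤ opNorm M + opNorm M' := by
  rw [opNorm, map_add]
  exact norm_add_le _ _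

theorem opNorm_sum_le {m ι : Type*} [Fintype m] [DecidableEq m] (s : Finset ι)
    (M : ι → Matrix m m ℂ) : opNorm (∑ i ∈ s, M i) ≤ ∑ i ∈ s, opNorm (M i) := by
  rw [opNorm, map_sum]
  exact norm_sum_le _ _

theorem opNorm_mul_le {m : Type*} [Fintype m] [DecidableEq m] (M M' : Matrix m m ℂ) :
    opNorm (M * M') ≤ opNorm M * opNorm M' := by
  rw [opNorm, map_mul]
  exact norm_mul_le _ _

theorem opNorm_smul {m : Type*} [Fintype m] [DecidableEq m] (c : ℂ) (M : Matrix m m ℂ) :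
    opNorm (c • M) = ‖c‖ * opNorm M := by
  rw [opNorm, map_smul, norm_smul, opNorm]

theorem opNorm_real_smul {m : Type*} [Fintype m] [DecidableEq m] {r : ℝ} (hr : 0 ≤ r)
    (M : Matrix m m ℂ) : opNorm ((r : ℂ) • M) = r * opNorm M := by
  rw [opNorm_smul, Complex.norm_real, Real.norm_of_nonneg hr]

open scoped Matrix.Norms.L2Operator in
/-- Tensoring with the identity is a `*`-homomorphism, hence contractive. -/
theorem opNorm_kronecker_one_le {m n : Type*} [Fintype m] [DecidableEq m] [Fintype n]
    [DecidableEq n] (M : Matrix m m ℂ) :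
    opNorm (M ⊗ₖ (1 : Matrix n n ℂ)) ≤ opNorm M := by
  let φ : Matrix m m ℂ →⋆ₙₐ[ℂ] Matrix (m × n) (m × n) ℂ :=
    { toFun := fun M => M ⊗ₖ (1 : Matrix n n ℂ)
      map_smul' := fun c M => Matrix.smul_kronecker c M 1
      map_zero' := Matrix.zero_kronecker _
      map_add' := fun M M' => Matrix.add_kronecker M M' 1
      map_mul' := fun M M' => by rw [← Matrix.mul_kronecker_mul, one_mul]
      map_star' := fun M => by
        simp only [Matrix.star_eq_conjTranspose, Matrix.conjTranspose_kronecker,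
          Matrix.conjTranspose_one] }
  exact NonUnitalStarAlgHom.norm_apply_le φ M

open scoped Matrix Matrix.Norms.L2Operator in
/-- Compressing a matrix to a principal submatrix does not increase its operator norm. -/
theorem opNorm_submatrix_le {m n : Type*} [Fintype m] [DecidableEq m] [Fintype n]
    [DecidableEq n] (M : Matrix m m ℂ) {f : n → m} (hf : Function.Injective f) :
    opNorm (M.submatrix f f) ≤ opNorm M := by
  let W : Matrix m n ℂ := (1 : Matrix m m ℂ).submatrix id f
  have hWs : Wᴴ = (1 : Matrix m m ℂ).submatrix f id := by
    rw [Matrix.conjTranspose_submatrix, Matrix.conjTranspose_one]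
  have hWW : Wᴴ * W = 1 := by
    rw [hWs, ← Matrix.submatrix_mul _ _ f id f Function.bijective_id, one_mul,
      Matrix.submatrix_one _ hf]
  have hM : M.submatrix f f = Wᴴ * M * W := by
    have h₁ : Wᴴ * M = M.submatrix f id := by
      conv_lhs => rw [hWs, ← Matrix.submatrix_id_id M]
      rw [← Matrix.submatrix_mul _ _ f id id Function.bijective_id, one_mul]
    rw [h₁, ← Matrix.submatrix_mul _ _ f id f Function.bijective_id, mul_one]
  have hW : ‖W‖ ≤ 1 := by
    have h₁ := Matrix.l2_opNorm_conjTranspose_mul_self W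
    rw [hWW] at h₁
    have h₂ : ‖(1 : Matrix n n ℂ)‖ ≤ 1 := opNorm_one_le
    nlinarith [norm_nonneg W]
  have hW' : ‖Wᴴ‖ ≤ 1 := by rwa [Matrix.l2_opNorm_conjTranspose]
  rw [hM, opNorm_eq_l2_norm, opNorm_eq_l2_norm]
  calc ‖Wᴴ * M * W‖ ≤ ‖Wᴴ‖ * ‖M‖ * ‖W‖ :=
        (Matrix.l2_opNorm_mul _ _).trans
          (mul_le_mul_of_nonneg_right (Matrix.l2_opNorm_mul _ _) (norm_nonneg _))
    _ ≤ 1 * ‖M‖ * 1 := by gcongr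
    _ = ‖M‖ := by ring

open scoped Matrix.Norms.L2Operator in
/-- Neumann series bound for the inverse of `1 - K` when `‖K‖ ≤ r < 1`. -/
theorem exists_inverse_one_sub {m : Type*} [Fintype m] [DecidableEq m] {K : Matrix m m ℂ} {r : ℝ}
    (hr : r < 1) (hK : opNorm K ≤ r) :
    ∃ T : Matrix m m ℂ, T * (1 - K) = 1 ∧ opNorm T * (1 - r) ≤ 1 := by
  have hK' : ‖K‖ < 1 := lt_of_le_of_lt hK hr
  let u := Units.oneSub K hK'
  have hu : (↑u⁻¹ : Matrix m m ℂ) * (1 - K) = 1 := u.inv_mul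
  refine ⟨↑u⁻¹, hu, ?_⟩
  have hT : (↑u⁻¹ : Matrix m m ℂ) = 1 + (↑u⁻¹ : Matrix m m ℂ) * K := by
    rw [mul_sub, mul_one] at hu
    rw [← hu, sub_add_cancel]
  have h₁ : opNorm (↑u⁻¹ : Matrix m m ℂ) ≤ 1 + opNorm (↑u⁻¹ : Matrix m m ℂ) * r := by
    conv_lhs => rw [hT]
    refine (opNorm_add_le _ _).trans (add_le_add opNorm_one_le ((opNorm_mul_le _ _).trans ?_))
    exact mul_le_mul_of_nonneg_left hK (opNorm_nonneg _)
  linarith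

/-- If `diag(p, 1) = u · diag(L, 1) · v` where the corner column of `u` and the corner row of `v`
are those of the identity, then the corner entry of `L⁻¹` is `p⁻¹`. -/
theorem corner_inverse_of_diag_eq {R ι κ m e : Type*} [Ring R] [IsStablyFiniteRing R]
    [Fintype ι] [DecidableEq ι] [Fintype κ] [DecidableEq κ] [Fintype m] [DecidableEq m]
    [Fintype e] [DecidableEq e] (f : Fin 1 ⊕ ι ≃ e) (g : m ⊕ κ ≃ e) (k : m)
    (hfg : g (Sum.inl k) = f (Sum.inl 0)) {p q : R} (hpq : p * q = 1) {L G : Matrix m m R}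
    (hGL : G * L = 1) {u v : Matrix e e R}
    (hu : ∀ i, u i (f (Sum.inl 0)) = if i = f (Sum.inl 0) then 1 else 0)
    (hv : ∀ i, v (f (Sum.inl 0)) i = if i = f (Sum.inl 0) then 1 else 0)
    (h : Matrix.reindex f f (Matrix.fromBlocks (Matrix.of fun _ _ => p) 0 0 1) =
      u * Matrix.reindex g g (Matrix.fromBlocks L 0 0 1) * v) :
    G k k = q := by
  let D := Matrix.reindex g g (Matrix.fromBlocks L 0 0 1)
  let D' := Matrix.reindex g g (Matrix.fromBlocks G 0 0 1)
  let W := Matrix.reindex f f (Matrix.fromBlocks (Matrix.of fun _ _ => q) 0 0 (1 : Matrix ι ι R))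
  have hD : D' * D = 1 := by
    simp only [D, D', Matrix.reindex_apply, Matrix.submatrix_mul_equiv,
      Matrix.fromBlocks_multiply, hGL]
    simp
  have hW : u * D * v * W = 1 := by
    have hpq' : (Matrix.of fun _ _ => p : Matrix (Fin 1) (Fin 1) R) *
        Matrix.of (fun _ _ => q) = 1 := by
      ext i j
      obtain rfl := Subsingleton.elim i j
      simp [Matrix.mul_apply, hpq]
    rw [← h]
    simp only [W, Matrix.reindex_apply, Matrix.submatrix_mul_equiv,
      Matrix.fromBlocks_multiply, hpq']
    simp
  have hW' : D * (v * W * u) = 1 := by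
    have : u * (D * (v * W)) = 1 := by simpa only [mul_assoc] using hW
    simpa only [mul_assoc] using mul_eq_one_symm this
  have hvWu : v * W * u = D' := by
    rw [← one_mul (v * W * u), ← hD, mul_assoc, hW', mul_one]
  have h₀ := congrFun (congrFun hvWu (f (Sum.inl 0))) (f (Sum.inl 0))
  have h₁ : D' (f (Sum.inl 0)) (f (Sum.inl 0)) = G k k := by
    simp [D', ← hfg]
  rw [h₁] at h₀
  rw [← h₀, Matrix.mul_apply]
  simp [hu, hv, Matrix.mul_apply, W]

theorem ncEval_smul_of_homogeneousDeg {d n j : ℕ} {p : FreeAlgebra ℂ (Fin d)}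
    (hp : HomogeneousDeg j p) (t : ℂ) (X : Fin d → Matrix (Fin n) (Fin n) ℂ) :
    ncEval (fun i => t • X i) p = t ^ j • ncEval X p := by
  have h := congrArg (ncEval X) (hp t)
  rw [map_smul] at h
  rw [← h, ← AlgHom.comp_apply]
  congr 1
  ext i
  simp [ncEval]

theorem memBallQ_real_smul {d l n : ℕ} {Q : Fin d → Matrix (Fin l) (Fin l) ℂ}
    {X : Fin d → Matrix (Fin n) (Fin n) ℂ} (hX : memBallQ Q X) {r : ℝ} (hr : 0 ≤ r) (hr1 : r ≤ 1) :
    memBallQ Q (fun i => (r : ℂ) • X i) := by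
  unfold memBallQ at *
  simp only [Matrix.kronecker_smul, ← Finset.smul_sum, opNorm_real_smul hr]
  exact (mul_le_of_le_one_left (opNorm_nonneg _) hr1).trans_lt hX

theorem ofReal_opNorm_ncEval_le_normQ1 {d l n : ℕ} {Q : Fin d → Matrix (Fin l) (Fin l) ℂ}
    (p : FreeAlgebra ℂ (Fin d)) {X : Fin d → Matrix (Fin (n + 1)) (Fin (n + 1)) ℂ}
    (hX : memBallQ Q X) : ENNReal.ofReal (opNorm (ncEval X p)) ≤ normQ1 Q p :=
  le_iSup_of_le n (le_iSup_of_le X (le_iSup_of_le hX le_rfl))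

theorem comp_map_ncEval_pencil {d m n : ℕ} (A : Fin d → Matrix (Fin m) (Fin m) ℂ)
    (Y : Fin d → Matrix (Fin n) (Fin n) ℂ) :
    Matrix.compRingEquiv (Fin m) (Fin n) ℂ
        ((1 - ∑ j, Matrix.of fun p q => A j p q • FreeAlgebra.ι ℂ j :
          Matrix (Fin m) (Fin m) (FreeAlgebra ℂ (Fin d))).map (ncEval Y)) =
      1 - ∑ j, A j ⊗ₖ Y j := by
  have h₁ : (1 - ∑ j, Matrix.of fun p q => A j p q • FreeAlgebra.ι ℂ j :
          Matrix (Fin m) (Fin m) (FreeAlgebra ℂ (Fin d))).map (ncEval Y) =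
      1 - ∑ j, Matrix.of fun p q => A j p q • Y j := by
    ext1 p q
    simp [Matrix.sum_apply, Matrix.one_apply, ncEval, apply_ite]
  rw [h₁, map_sub, map_one, map_sum]
  rfl

/-- A left inverse of the pencil at `rX`, with norm at most `κ(S) / (1 - r)`. -/
theorem exists_inverse_pencil {d m n : ℕ} {A : Fin d → Matrix (Fin m) (Fin m) ℂ}
    {S : Matrix (Fin m) (Fin m) ℂ} (hS : IsUnit S.det)
    {X : Fin d → Matrix (Fin n) (Fin n) ℂ}
    (hB : opNorm (∑ j, (S⁻¹ * A j * S) ⊗ₖ X j) ≤ 1) {r : ℝ} (hr : 0 ≤ r) (hr1 : r < 1) :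
    ∃ T : Matrix (Fin m × Fin n) (Fin m × Fin n) ℂ,
      T * (1 - ∑ j, A j ⊗ₖ ((r : ℂ) • X j)) = 1 ∧
        opNorm T * (1 - r) ≤ opNorm S * opNorm S⁻¹ := by
  let E : Matrix (Fin n) (Fin n) ℂ := 1
  let K := (r : ℂ) • ∑ j, (S⁻¹ * A j * S) ⊗ₖ X j
  have hK : opNorm K ≤ r := by
    rw [opNorm_real_smul hr]
    exact mul_le_of_le_one_right hr hB
  obtain ⟨T, hT, hTn⟩ := exists_inverse_one_sub hr1 hK
  have hSS : (S ⊗ₖ E) * (S⁻¹ ⊗ₖ E) = 1 := by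
    rw [← Matrix.mul_kronecker_mul, Matrix.mul_nonsing_inv _ hS, one_mul, Matrix.one_kronecker_one]
  have hSS' : (S⁻¹ ⊗ₖ E) * (S ⊗ₖ E) = 1 := by
    rw [← Matrix.mul_kronecker_mul, Matrix.nonsing_inv_mul _ hS, one_mul, Matrix.one_kronecker_one]
  have hK' : (S⁻¹ ⊗ₖ E) * (1 - ∑ j, A j ⊗ₖ ((r : ℂ) • X j)) = (1 - K) * (S⁻¹ ⊗ₖ E) := by
    simp only [K, mul_sub, sub_mul, mul_one, one_mul, Finset.mul_sum, Finset.sum_mul,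
      Finset.smul_sum, smul_mul_assoc, Matrix.kronecker_smul, mul_smul_comm,
      ← Matrix.mul_kronecker_mul, E]
    simp only [mul_assoc, Matrix.mul_nonsing_inv _ hS, mul_one]
  refine ⟨(S ⊗ₖ E) * T * (S⁻¹ ⊗ₖ E), ?_, ?_⟩
  · rw [mul_assoc, hK', mul_assoc, ← mul_assoc T, hT, one_mul, hSS]
  · have h₁ : opNorm ((S ⊗ₖ E) * T * (S⁻¹ ⊗ₖ E)) ≤ opNorm S * opNorm T * opNorm S⁻¹ := by
      refine (opNorm_mul_le _ _).trans (mul_le_mul ((opNorm_mul_le _ _).trans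
        (mul_le_mul_of_nonneg_right (opNorm_kronecker_one_le _) (opNorm_nonneg _)))
        (opNorm_kronecker_one_le _) (opNorm_nonneg _)
        (mul_nonneg (opNorm_nonneg _) (opNorm_nonneg _)))
    calc _ ≤ opNorm S * opNorm T * opNorm S⁻¹ * (1 - r) :=
          mul_le_mul_of_nonneg_right h₁ (by linarith)
      _ = opNorm S * opNorm S⁻¹ * (opNorm T * (1 - r)) := by ring
      _ ≤ opNorm S * opNorm S⁻¹ * 1 :=
          mul_le_mul_of_nonneg_left hTn (mul_nonneg (opNorm_nonneg _) (opNorm_nonneg _))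
      _ = _ := mul_one _

theorem one_sub_pow_le_natCast_mul {r : ℝ} (hr : 0 ≤ r) (j : ℕ) :
    1 - r ^ j ≤ j * (1 - r) := by
  have h := one_add_mul_le_pow (a := r - 1) (by linarith) j
  rw [add_sub_cancel] at h
  linarith

/-- `‖P(X) - P(rX)‖ ≤ (1 - r) ∑ j ‖P_j(X)‖`. -/
theorem opNorm_ncEval_sub_ncEval_real_smul_le {d n N : ℕ} {Pj : ℕ → FreeAlgebra ℂ (Fin d)}
    (hPj : ∀ j, HomogeneousDeg j (Pj j)) (X : Fin d → Matrix (Fin n) (Fin n) ℂ)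
    {r : ℝ} (hr : 0 ≤ r) (hr1 : r ≤ 1) :
    opNorm (ncEval X (∑ j ∈ Finset.range (N + 1), Pj j) -
        ncEval (fun i => (r : ℂ) • X i) (∑ j ∈ Finset.range (N + 1), Pj j)) ≤
      (1 - r) * ∑ j ∈ Finset.Icc 1 N, j * opNorm (ncEval X (Pj j)) := by
  have h₁ : ncEval X (∑ j ∈ Finset.range (N + 1), Pj j) -
        ncEval (fun i => (r : ℂ) • X i) (∑ j ∈ Finset.range (N + 1), Pj j) =
      ∑ j ∈ Finset.range (N + 1), ((1 - r ^ j : ℝ) : ℂ) • ncEval X (Pj j) := by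
    simp only [map_sum, ← Finset.sum_sub_distrib, ncEval_smul_of_homogeneousDeg (hPj _)]
    refine Finset.sum_congr rfl fun j _ => ?_
    push_cast
    rw [sub_smul, one_smul]
  have h₂ : ∑ j ∈ Finset.Icc 1 N, (j : ℝ) * opNorm (ncEval X (Pj j)) =
      ∑ j ∈ Finset.range (N + 1), (j : ℝ) * opNorm (ncEval X (Pj j)) := by
    refine Finset.sum_subset (fun j hj => ?_) fun j hj hj' => ?_
    · simp only [Finset.mem_Icc, Finset.mem_range] at *
      omega
    · obtain rfl : j = 0 := by
        simp only [Finset.mem_Icc, Finset.mem_range] at *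
        omega
      simp
  rw [h₁, h₂, Finset.mul_sum]
  refine (opNorm_sum_le _ _).trans (Finset.sum_le_sum fun j _ => ?_)
  rw [opNorm_real_smul (by linarith [pow_le_one₀ (n := j) hr hr1])]
  calc _ ≤ (j * (1 - r)) * opNorm (ncEval X (Pj j)) :=
        mul_le_mul_of_nonneg_right (one_sub_pow_le_natCast_mul hr j) (opNorm_nonneg _)
    _ = _ := by ring

/-- **Improved NGN bounds via uni-triangular linearization.**
Let `P ∈ ℂ⟨Z⟩` be `Q`-stable with homogeneous expansion `P = ∑_{j=0}^N P_j`, and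
suppose `diag(P, I_{l₁}) = U · diag(L_A, I_{l₂}) · V` with `U` upper and `V` lower
uni-triangular, where `L_A` is a monic pencil of size `m`, `1 + l₁ = m + l₂`, and
`S⁻¹AS = B` satisfies `‖∑_j B_j ⊗ X_j‖ ≤ 1` on `𝔻_Q`. Then for `r ∈ [0,1)` and
`X ∈ 𝔻_Q`, `P(rX)` is invertible and both `‖P(X)P(rX)⁻¹‖` and `‖P(rX)⁻¹P(X)‖` are
bounded by `1 + κ(S)·∑_{j=1}^N j‖P_j‖_Q` in `[0,∞]`, where `κ(S) = ‖S‖‖S⁻¹‖`. -/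
theorem ngn_improved_bounds_unitriangular {d l : ℕ} (hd : 0 < d) (hl : 0 < l)
    (Q : Fin d → Matrix (Fin l) (Fin l) ℂ) (hQ : LinearIndependent ℂ Q)
    (P : FreeAlgebra ℂ (Fin d))
    (hstable : ∀ (n : ℕ) (X : Fin d → Matrix (Fin (n + 1)) (Fin (n + 1)) ℂ),
      memBallQ Q X → IsUnit (ncEval X P))
    (N : ℕ) (Pj : ℕ → FreeAlgebra ℂ (Fin d))
    (hPj : ∀ j, HomogeneousDeg j (Pj j))
    (hP : P = ∑ j ∈ Finset.range (N + 1), Pj j)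
    (m : ℕ) (hm : 0 < m) (A : Fin d → Matrix (Fin m) (Fin m) ℂ)
    (l₁ l₂ : ℕ) (he : 1 + l₁ = m + l₂)
    (U V : Matrix (Fin (1 + l₁)) (Fin (1 + l₁)) (FreeAlgebra ℂ (Fin d)))
    (hU : (∀ i, U i i = 1) ∧ ∀ i j, j < i → U i j = 0)
    (hV : (∀ i, V i i = 1) ∧ ∀ i j, i < j → V i j = 0)
    (LA : Matrix (Fin m) (Fin m) (FreeAlgebra ℂ (Fin d)))
    (hLA : LA = 1 - ∑ j, Matrix.of fun p q => A j p q • FreeAlgebra.ι ℂ j)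
    (hlin :
      Matrix.reindex finSumFinEquiv finSumFinEquiv
          (Matrix.fromBlocks (Matrix.of fun _ _ => P) 0 0
            (1 : Matrix (Fin l₁) (Fin l₁) (FreeAlgebra ℂ (Fin d)))) =
        U * Matrix.reindex (finCongr he.symm) (finCongr he.symm)
              (Matrix.reindex finSumFinEquiv finSumFinEquiv
                (Matrix.fromBlocks LA 0 0
                  (1 : Matrix (Fin l₂) (Fin l₂) (FreeAlgebra ℂ (Fin d))))) * V)
    (S : Matrix (Fin m) (Fin m) ℂ) (hS : IsUnit S.det)
    (hB : ∀ (n : ℕ) (X : Fin d → Matrix (Fin (n + 1)) (Fin (n + 1)) ℂ),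
      memBallQ Q X → opNorm (∑ j, (S⁻¹ * A j * S) ⊗ₖ X j) ≤ 1) :
    ∀ (r : ℝ), 0 ≤ r → r < 1 →
      ∀ (n : ℕ) (X : Fin d → Matrix (Fin (n + 1)) (Fin (n + 1)) ℂ), memBallQ Q X →
        IsUnit (ncEval (fun i => (r : ℂ) • X i) P) ∧
        ENNReal.ofReal
            (opNorm (ncEval X P * (ncEval (fun i => (r : ℂ) • X i) P)⁻¹)) ≤
          1 + ENNReal.ofReal (opNorm S * opNorm S⁻¹) *
            ∑ j ∈ Finset.Icc 1 N, (j : ℝ≥0∞) * normQ1 Q (Pj j) ∧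
        ENNReal.ofReal
            (opNorm ((ncEval (fun i => (r : ℂ) • X i) P)⁻¹ * ncEval X P)) ≤
          1 + ENNReal.ofReal (opNorm S * opNorm S⁻¹) *
            ∑ j ∈ Finset.Icc 1 N, (j : ℝ≥0∞) * normQ1 Q (Pj j) := by
  intro r hr hr1 n X hX
  have hp := hstable n _ (memBallQ_real_smul hX hr hr1.le)
  obtain ⟨T, hT, hTn⟩ := exists_inverse_pencil hS (hB n X hX) hr hr1
  set Y : Fin d → Matrix (Fin (n + 1)) (Fin (n + 1)) ℂ := fun i => (r : ℂ) • X i with hY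
  have hdet := (Matrix.isUnit_iff_isUnit_det _).mp hp
  let G := (Matrix.compRingEquiv (Fin m) (Fin (n + 1)) ℂ).symm T
  have hGL : G * LA.map (ncEval Y) = 1 := by
    apply (Matrix.compRingEquiv (Fin m) (Fin (n + 1)) ℂ).injective
    rw [map_mul, map_one, hLA, comp_map_ncEval_pencil, RingEquiv.apply_symm_apply]
    exact hT
  have hcorner : G ⟨0, hm⟩ ⟨0, hm⟩ = (ncEval Y P)⁻¹ := by
    have h0 : (finSumFinEquiv (Sum.inl 0) : Fin (1 + l₁)) = ⟨0, by omega⟩ := by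
      ext
      simp
    refine corner_inverse_of_diag_eq (finSumFinEquiv (m := 1) (n := l₁))
      ((finSumFinEquiv (m := m) (n := l₂)).trans (finCongr he.symm)) ⟨0, hm⟩ ?_
      (Matrix.mul_nonsing_inv _ hdet) hGL (u := U.map (ncEval Y)) (v := V.map (ncEval Y)) ?_ ?_ ?_
    · ext
      simp
    · intro i
      rw [h0, Matrix.map_apply]
      split_ifs with hi
      · rw [hi, hU.1, map_one]
      · rw [hU.2 _ _ (by rw [Fin.lt_def]; exact Nat.pos_of_ne_zero fun h => hi (Fin.ext h)),
          map_zero]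
    · intro i
      rw [h0, Matrix.map_apply]
      split_ifs with hi
      · rw [hi, hV.1, map_one]
      · rw [hV.2 _ _ (by rw [Fin.lt_def]; exact Nat.pos_of_ne_zero fun h => hi (Fin.ext h)),
          map_zero]
    · have h := congrArg (fun M => M.map (ncEval Y)) hlin
      simp only [Matrix.map_mul, Matrix.reindex_apply, ← Matrix.submatrix_map,
        Matrix.fromBlocks_map, Matrix.submatrix_submatrix] at h
      have hPY : (Matrix.of fun _ _ => P : Matrix (Fin 1) (Fin 1) _).map (ncEval Y) =
          Matrix.of fun _ _ => ncEval Y P := rfl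
      simpa [Matrix.map_zero, Matrix.map_one, Function.comp_def, hPY] using h
  have hinv : opNorm (ncEval Y P)⁻¹ * (1 - r) ≤ opNorm S * opNorm S⁻¹ := by
    refine (mul_le_mul_of_nonneg_right ?_ (by linarith)).trans hTn
    rw [← hcorner]
    exact opNorm_submatrix_le T (f := fun a => ((⟨0, hm⟩ : Fin m), a)) (Prod.mk_right_injective _)
  set c := ∑ j ∈ Finset.Icc 1 N, (j : ℝ) * opNorm (ncEval X (Pj j)) with hc
  have hc0 : 0 ≤ c := Finset.sum_nonneg fun j _ => mul_nonneg j.cast_nonneg (opNorm_nonneg _)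
  have hdiff : opNorm (ncEval X P - ncEval Y P) ≤ (1 - r) * c := by
    rw [hP]
    exact opNorm_ncEval_sub_ncEval_real_smul_le hPj X hr hr1.le
  have hprod : opNorm (ncEval X P - ncEval Y P) * opNorm (ncEval Y P)⁻¹ ≤
      opNorm S * opNorm S⁻¹ * c := by
    calc _ ≤ (1 - r) * c * opNorm (ncEval Y P)⁻¹ :=
          mul_le_mul_of_nonneg_right hdiff (opNorm_nonneg _)
      _ = opNorm (ncEval Y P)⁻¹ * (1 - r) * c := by ring
      _ ≤ _ := mul_le_mul_of_nonneg_right hinv hc0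
  have hfin : ∀ M : Matrix (Fin (n + 1)) (Fin (n + 1)) ℂ,
      opNorm M ≤ 1 + opNorm S * opNorm S⁻¹ * c →
      ENNReal.ofReal (opNorm M) ≤ 1 + ENNReal.ofReal (opNorm S * opNorm S⁻¹) *
        ∑ j ∈ Finset.Icc 1 N, (j : ℝ≥0∞) * normQ1 Q (Pj j) := by
    intro M hM
    have hκ : 0 ≤ opNorm S * opNorm S⁻¹ := mul_nonneg (opNorm_nonneg _) (opNorm_nonneg _)
    refine (ENNReal.ofReal_le_ofReal hM).trans ?_
    rw [ENNReal.ofReal_add zero_le_one (mul_nonneg hκ hc0), ENNReal.ofReal_one,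
      ENNReal.ofReal_mul hκ, hc, ENNReal.ofReal_sum_of_nonneg
        fun j _ => mul_nonneg j.cast_nonneg (opNorm_nonneg _)]
    gcongr with j
    rw [ENNReal.ofReal_mul j.cast_nonneg, ENNReal.ofReal_natCast]
    gcongr
    exact ofReal_opNorm_ncEval_le_normQ1 _ hX
  refine ⟨hp, hfin _ ?_, hfin _ ?_⟩
  · have h : ncEval X P * (ncEval Y P)⁻¹ =
        1 + (ncEval X P - ncEval Y P) * (ncEval Y P)⁻¹ := by
      rw [sub_mul, Matrix.mul_nonsing_inv _ hdet, add_sub_cancel]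
    rw [h]
    exact (opNorm_add_le _ _).trans
      (add_le_add opNorm_one_le ((opNorm_mul_le _ _).trans hprod))
  · have h : (ncEval Y P)⁻¹ * ncEval X P =
        1 + (ncEval Y P)⁻¹ * (ncEval X P - ncEval Y P) := by
      rw [mul_sub, Matrix.nonsing_inv_mul _ hdet, add_sub_cancel]
    rw [h]
    refine (opNorm_add_le _ _).trans (add_le_add opNorm_one_le ((opNorm_mul_le _ _).trans ?_))
    rwa [mul_comm]
end

section
/- Lemma (uniform boundedness of inverses of dilated stable polynomials): Let P ∈ M_k(ℂ⟨Z⟩) be Q-stable. Then for every fixed r ∈ [0,1) there exists a finite constant C_r such that for every n ≥ 1 and every X ∈ 𝔻_Q(n), the matrix P(rX) is invertible and ‖P(rX)⁻¹‖ ≤ C_r; that is, the NC function X ↦ P(rX)⁻¹ is uniformly bounded on the ball 𝔻_Q. -/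
open scoped Kronecker ENNReal

section

open scoped Matrix Matrix.Norms.L2Operator

/-- The space of free polynomials of degree at most one. -/
def affinePoly (d : ℕ) : Submodule ℂ (FreeAlgebra ℂ (Fin d)) :=
  1 ⊔ Submodule.span ℂ (Set.range (FreeAlgebra.ι ℂ))

lemma one_le_affinePoly (d : ℕ) : 1 ≤ affinePoly d := le_sup_left

lemma affinePoly_pow_fg (d D : ℕ) : (affinePoly d ^ D).FG := by
  refine Submodule.FG.pow (Submodule.FG.sup ?_ (Submodule.fg_span (Set.finite_range _))) D
  rw [Submodule.one_eq_span]
  exact Submodule.fg_span_singleton _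

lemma exists_mem_affinePoly_pow {d : ℕ} (p : FreeAlgebra ℂ (Fin d)) :
    ∃ D, p ∈ affinePoly d ^ D := by
  induction p using FreeAlgebra.induction with
  | grade0 c => exact ⟨0, by rw [pow_zero]; exact Submodule.mem_one.2 ⟨c, rfl⟩⟩
  | grade1 i =>
    refine ⟨1, ?_⟩
    rw [pow_one]
    exact Submodule.mem_sup_right (Submodule.subset_span ⟨i, rfl⟩)
  | mul a b ha hb =>
    obtain ⟨m, hm⟩ := ha
    obtain ⟨n, hn⟩ := hb
    exact ⟨m + n, by rw [pow_add]; exact Submodule.mul_mem_mul hm hn⟩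
  | add a b ha hb =>
    obtain ⟨m, hm⟩ := ha
    obtain ⟨n, hn⟩ := hb
    exact ⟨max m n, add_mem
      (pow_le_pow_right' (one_le_affinePoly d) (le_max_left m n) hm)
      (pow_le_pow_right' (one_le_affinePoly d) (le_max_right m n) hn)⟩

lemma exists_forall_mem_affinePoly_pow {d k : ℕ}
    (P : Matrix (Fin k) (Fin k) (FreeAlgebra ℂ (Fin d))) :
    ∃ D, ∀ i j, P i j ∈ affinePoly d ^ D := by
  choose D hD using fun ij : Fin k × Fin k => exists_mem_affinePoly_pow (P ij.1 ij.2)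
  exact ⟨Finset.univ.sup D, fun i j => pow_le_pow_right' (one_le_affinePoly d)
    (Finset.le_sup (Finset.mem_univ (i, j))) (hD (i, j))⟩

/-- The compression of a tuple of matrices along `U`. -/
def compress {d n m : ℕ} (U : Matrix (Fin n) (Fin m) ℂ)
    (Y : Fin d → Matrix (Fin n) (Fin n) ℂ) (j : Fin d) : Matrix (Fin m) (Fin m) ℂ :=
  Uᴴ * Y j * U

lemma ncEval_compress_of_mem_affinePoly {d n m : ℕ} {U : Matrix (Fin n) (Fin m) ℂ}
    (hU : Uᴴ * U = 1) (Y : Fin d → Matrix (Fin n) (Fin n) ℂ) {a : FreeAlgebra ℂ (Fin d)}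
    (ha : a ∈ affinePoly d) : ncEval (compress U Y) a = Uᴴ * ncEval Y a * U := by
  obtain ⟨b, hb, c, hc, rfl⟩ := Submodule.mem_sup.1 ha
  obtain ⟨z, rfl⟩ := Submodule.mem_one.1 hb
  have h : ncEval (compress U Y) c = Uᴴ * ncEval Y c * U := by
    clear ha
    induction hc using Submodule.span_induction with
    | mem x hx =>
      obtain ⟨i, rfl⟩ := hx
      simp [ncEval, compress]
    | zero => simp
    | add x y _ _ hx hy => simp [hx, hy, Matrix.mul_add, Matrix.add_mul]
    | smul t x _ hx => simp [hx]
  simp only [map_add, h, Matrix.mul_add, Matrix.add_mul, Algebra.algebraMap_eq_smul_one,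
    map_smul, map_one, Matrix.mul_smul, Matrix.smul_mul, Matrix.mul_one, hU]

lemma ncEval_mulVec_eq_compress {d n m : ℕ} {U : Matrix (Fin n) (Fin m) ℂ}
    (hU : Uᴴ * U = 1) (Y : Fin d → Matrix (Fin n) (Fin n) ℂ) (u : Fin n → ℂ) (D : ℕ)
    (h : ∀ q ∈ affinePoly d ^ D, U *ᵥ (Uᴴ *ᵥ (ncEval Y q *ᵥ u)) = ncEval Y q *ᵥ u)
    {p : FreeAlgebra ℂ (Fin d)} (hp : p ∈ affinePoly d ^ D) :
    ncEval Y p *ᵥ u = U *ᵥ (ncEval (compress U Y) p *ᵥ (Uᴴ *ᵥ u)) := by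
  induction D generalizing p with
  | zero =>
    have h1 := h 1 (by rw [pow_zero]; exact Submodule.one_le.1 le_rfl)
    rw [pow_zero] at hp
    obtain ⟨z, rfl⟩ := Submodule.mem_one.1 hp
    simp only [map_one, Matrix.one_mulVec] at h1
    simp only [Algebra.algebraMap_eq_smul_one, map_smul, map_one, Matrix.smul_mulVec,
      Matrix.one_mulVec, Matrix.mulVec_smul, h1]
  | succ D ih =>
    have ih' := @ih fun q hq => h q (pow_le_pow_right' (one_le_affinePoly d) D.le_succ hq)
    rw [pow_succ'] at hp
    induction hp using Submodule.mul_induction_on' with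
    | mem_mul_mem a ha q hq =>
      have haq := h (a * q) (by rw [pow_succ']; exact Submodule.mul_mem_mul ha hq)
      rw [map_mul, map_mul, ncEval_compress_of_mem_affinePoly hU Y ha]
      simp only [← Matrix.mulVec_mulVec, ← ih' hq]
      simpa only [map_mul, ← Matrix.mulVec_mulVec] using haq.symm
    | add x _ y _ hx hy => simp only [map_add, Matrix.add_mulVec, Matrix.mulVec_add, hx, hy]

lemma exists_isometry_onto_range {n : ℕ} {E : Type*} [AddCommGroup E] [Module ℂ E]
    [FiniteDimensional ℂ E] (L : E →ₗ[ℂ] (Fin n → ℂ)) :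
    ∃ m ≤ Module.finrank ℂ E, ∃ U : Matrix (Fin n) (Fin m) ℂ,
      Uᴴ * U = 1 ∧ ∀ x, U *ᵥ (Uᴴ *ᵥ L x) = L x := by
  let L' : E →ₗ[ℂ] EuclideanSpace ℂ (Fin n) := (WithLp.linearEquiv 2 ℂ (Fin n → ℂ)).symm ∘ₗ L
  let b := stdOrthonormalBasis ℂ (LinearMap.range L')
  refine ⟨_, LinearMap.finrank_range_le L', Matrix.of fun i j => (b j : EuclideanSpace ℂ (Fin n)) i,
    ?_, fun x => ?_⟩
  · ext i j
    have := orthonormal_iff_ite.1 b.orthonormal i j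
    rw [Submodule.coe_inner, PiLp.inner_apply] at this
    simpa [Matrix.mul_apply, Matrix.one_apply, mul_comm] using this
  · ext a
    have := congrArg (fun z : LinearMap.range L' => (z : EuclideanSpace ℂ (Fin n)) a)
      (b.sum_repr' ⟨L' x, x, rfl⟩)
    simp only [Submodule.coe_sum, Submodule.coe_smul, Submodule.coe_inner, PiLp.inner_apply] at this
    simpa [Matrix.mulVec, dotProduct, L', mul_comm] using this

lemma norm_le_one_of_conjTranspose_mul_self {m n : Type*} [Fintype m] [Fintype n]
    [DecidableEq m] [DecidableEq n] {V : Matrix m n ℂ} (h : Vᴴ * V = 1) : ‖V‖ ≤ 1 := by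
  have h1 : ‖(1 : Matrix n n ℂ)‖ ≤ 1 := by
    rw [Matrix.cstar_norm_def, map_one]
    exact ContinuousLinearMap.norm_id_le
  rw [← h, Matrix.l2_opNorm_conjTranspose_mul_self] at h1
  nlinarith [norm_nonneg V]

lemma norm_conj_isometry_le {m n : Type*} [Fintype m] [Fintype n]
    [DecidableEq m] [DecidableEq n] {V : Matrix m n ℂ} (h : Vᴴ * V = 1) (A : Matrix m m ℂ) :
    ‖Vᴴ * A * V‖ ≤ ‖A‖ := by
  have hV := norm_le_one_of_conjTranspose_mul_self h
  have hV' : ‖Vᴴ‖ ≤ 1 := by rwa [Matrix.l2_opNorm_conjTranspose]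
  calc ‖Vᴴ * A * V‖ ≤ ‖Vᴴ * A‖ * ‖V‖ := Matrix.l2_opNorm_mul _ _
    _ ≤ ‖Vᴴ * A‖ := mul_le_of_le_one_right (norm_nonneg _) hV
    _ ≤ ‖Vᴴ‖ * ‖A‖ := Matrix.l2_opNorm_mul _ _
    _ ≤ ‖A‖ := mul_le_of_le_one_left (norm_nonneg _) hV'

lemma norm_isometry_conj_le {m n : Type*} [Fintype m] [Fintype n]
    [DecidableEq m] [DecidableEq n] {V : Matrix m n ℂ} (h : Vᴴ * V = 1) (A : Matrix n n ℂ) :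
    ‖V * A * Vᴴ‖ ≤ ‖A‖ := by
  have hV := norm_le_one_of_conjTranspose_mul_self h
  have hV' : ‖Vᴴ‖ ≤ 1 := by rwa [Matrix.l2_opNorm_conjTranspose]
  calc ‖V * A * Vᴴ‖ ≤ ‖V * A‖ * ‖Vᴴ‖ := Matrix.l2_opNorm_mul _ _
    _ ≤ ‖V * A‖ := mul_le_of_le_one_right (norm_nonneg _) hV'
    _ ≤ ‖V‖ * ‖A‖ := Matrix.l2_opNorm_mul _ _
    _ ≤ ‖A‖ := mul_le_of_le_one_left (norm_nonneg _) hV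

lemma one_kronecker_isometry (k : ℕ) {n m : ℕ} {U : Matrix (Fin n) (Fin m) ℂ}
    (hU : Uᴴ * U = 1) :
    ((1 : Matrix (Fin k) (Fin k) ℂ) ⊗ₖ U)ᴴ * ((1 : Matrix (Fin k) (Fin k) ℂ) ⊗ₖ U) = 1 := by
  rw [Matrix.conjTranspose_kronecker, ← Matrix.mul_kronecker_mul, hU,
    Matrix.conjTranspose_one, Matrix.mul_one, Matrix.one_kronecker_one]

lemma one_kronecker_mulVec {k n m : ℕ} (U : Matrix (Fin n) (Fin m) ℂ)
    (w : Fin k × Fin m → ℂ) (i : Fin k) (a : Fin n) :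
    (((1 : Matrix (Fin k) (Fin k) ℂ) ⊗ₖ U) *ᵥ w) (i, a) = (U *ᵥ fun b => w (i, b)) a := by
  simp [Matrix.mulVec, dotProduct, Fintype.sum_prod_type, Matrix.one_apply, ite_mul,
    Finset.sum_ite_irrel]

lemma ncEvalM_mulVec {d k n : ℕ} (P : Matrix (Fin k) (Fin k) (FreeAlgebra ℂ (Fin d)))
    (Y : Fin d → Matrix (Fin n) (Fin n) ℂ) (w : Fin k × Fin n → ℂ) (i : Fin k) (a : Fin n) :
    (ncEvalM P Y *ᵥ w) (i, a) = ∑ j, (ncEval Y (P i j) *ᵥ fun b => w (j, b)) a := by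
  simp [ncEvalM, Matrix.mulVec, dotProduct, Fintype.sum_prod_type]

lemma norm_sum_kronecker_compress_le {d l n m : ℕ} (Q : Fin d → Matrix (Fin l) (Fin l) ℂ)
    {U : Matrix (Fin n) (Fin m) ℂ} (hU : Uᴴ * U = 1) (Y : Fin d → Matrix (Fin n) (Fin n) ℂ) :
    ‖∑ j, Q j ⊗ₖ compress U Y j‖ ≤ ‖∑ j, Q j ⊗ₖ Y j‖ := by
  refine le_trans (le_of_eq (congrArg _ ?_))
    (norm_conj_isometry_le (one_kronecker_isometry l hU) (∑ j, Q j ⊗ₖ Y j))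
  simp only [Matrix.mul_sum, Matrix.sum_mul, Matrix.conjTranspose_kronecker,
    Matrix.conjTranspose_one, ← Matrix.mul_kronecker_mul, Matrix.one_mul, Matrix.mul_one, compress]

/-- The action of `P(Y)` on a vector factors through a compression of `Y` to a subspace whose
dimension is bounded in terms of the size and the degree of `P` only. -/
lemma exists_compress_ncEvalM_mulVec {d k : ℕ} (D : ℕ)
    (P : Matrix (Fin k) (Fin k) (FreeAlgebra ℂ (Fin d))) (hP : ∀ i j, P i j ∈ affinePoly d ^ D)
    {n : ℕ} (Y : Fin d → Matrix (Fin n) (Fin n) ℂ) (v : Fin k × Fin n → ℂ) :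
    ∃ m ≤ Module.finrank ℂ (Fin k → (affinePoly d ^ D : Submodule ℂ (FreeAlgebra ℂ (Fin d)))),
      ∃ U : Matrix (Fin n) (Fin m) ℂ, Uᴴ * U = 1 ∧
        ((1 : Matrix (Fin k) (Fin k) ℂ) ⊗ₖ U) *ᵥ
          (((1 : Matrix (Fin k) (Fin k) ℂ) ⊗ₖ U)ᴴ *ᵥ v) = v ∧
        ncEvalM P Y *ᵥ v = ((1 : Matrix (Fin k) (Fin k) ℂ) ⊗ₖ U) *ᵥ (ncEvalM P (compress U Y) *ᵥ
          (((1 : Matrix (Fin k) (Fin k) ℂ) ⊗ₖ U)ᴴ *ᵥ v)) := by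
  have : Module.Finite ℂ (affinePoly d ^ D : Submodule ℂ (FreeAlgebra ℂ (Fin d))) :=
    Module.Finite.iff_fg.2 (affinePoly_pow_fg d D)
  let L : (Fin k → (affinePoly d ^ D : Submodule ℂ (FreeAlgebra ℂ (Fin d)))) →ₗ[ℂ] (Fin n → ℂ) :=
    { toFun := fun f => ∑ i, ncEval Y (f i : FreeAlgebra ℂ (Fin d)) *ᵥ fun b => v (i, b)
      map_add' := fun f g => by simp [Matrix.add_mulVec, Finset.sum_add_distrib]
      map_smul' := fun c f => by simp [Matrix.smul_mulVec, Finset.smul_sum] }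
  obtain ⟨m, hm, U, hU, hL⟩ := exists_isometry_onto_range L
  have hrange : ∀ i, ∀ q ∈ affinePoly d ^ D, U *ᵥ (Uᴴ *ᵥ (ncEval Y q *ᵥ fun b => v (i, b))) =
      ncEval Y q *ᵥ fun b => v (i, b) := by
    intro i q hq
    have hLi : L (Pi.single i ⟨q, hq⟩) = ncEval Y q *ᵥ fun b => v (i, b) := by
      change ∑ j : Fin k, _ = _
      rw [Finset.sum_eq_single i]
      · simp
      · intro j _ hj
        simp [Pi.single_eq_of_ne hj]
      · simp
    rw [← hLi]
    exact hL _
  have hone : (1 : FreeAlgebra ℂ (Fin d)) ∈ affinePoly d ^ D :=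
    Submodule.one_le.1 (one_le_pow_of_one_le' (one_le_affinePoly d) D)
  refine ⟨m, hm, U, hU, ?_, ?_⟩
  · ext ⟨i, a⟩
    rw [one_kronecker_mulVec, Matrix.conjTranspose_kronecker, Matrix.conjTranspose_one]
    simp only [one_kronecker_mulVec]
    simpa using congrFun (hrange i 1 hone) a
  · ext ⟨i, a⟩
    rw [one_kronecker_mulVec, Matrix.conjTranspose_kronecker, Matrix.conjTranspose_one,
      ncEvalM_mulVec]
    simp only [ncEvalM_mulVec, one_kronecker_mulVec]
    have hsum : (fun b => ∑ j, (ncEval (compress U Y) (P i j) *ᵥ fun c =>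
        (Uᴴ *ᵥ fun e => v (j, e)) c) b) =
        ∑ j, ncEval (compress U Y) (P i j) *ᵥ (Uᴴ *ᵥ fun e => v (j, e)) := by
      ext b
      rw [Finset.sum_apply]
    rw [hsum, Matrix.mulVec_sum, Finset.sum_apply]
    refine Finset.sum_congr rfl fun j _ => ?_
    rw [ncEval_mulVec_eq_compress hU Y _ D (hrange j) (hP i j)]

lemma isCompact_setOf_norm_sum_kronecker_le {d l : ℕ} {Q : Fin d → Matrix (Fin l) (Fin l) ℂ}
    (hQ : LinearIndependent ℂ Q) (n : ℕ) (r : ℝ) :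
    IsCompact {Y : Fin d → Matrix (Fin n) (Fin n) ℂ | ‖∑ j, Q j ⊗ₖ Y j‖ ≤ r} := by
  let T : (Fin d → Matrix (Fin n) (Fin n) ℂ) →ₗ[ℂ] Matrix (Fin l × Fin n) (Fin l × Fin n) ℂ :=
    { toFun := fun Y => ∑ j, Q j ⊗ₖ Y j
      map_add' := fun Y Z => by simp [Matrix.kronecker_add, Finset.sum_add_distrib]
      map_smul' := fun c Y => by simp [Matrix.kronecker_smul, Finset.smul_sum] }
  have hT : LinearMap.ker T = ⊥ := by
    refine LinearMap.ker_eq_bot'.2 fun Y hY => ?_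
    ext j a b
    refine Fintype.linearIndependent_iff.1 hQ (fun j => Y j a b) ?_ j
    ext x y
    have := congrFun (congrFun hY (x, a)) (y, b)
    simpa [T, Matrix.sum_apply, mul_comm] using this
  have : ProperSpace (Matrix (Fin l × Fin n) (Fin l × Fin n) ℂ) := FiniteDimensional.proper ℂ _
  have := (LinearMap.isClosedEmbedding_of_injective hT).isCompact_preimage
    (isCompact_closedBall (0 : Matrix (Fin l × Fin n) (Fin l × Fin n) ℂ) r)
  convert this using 1
  ext Y
  simp [T]

lemma continuous_ncEval {d n : ℕ} (p : FreeAlgebra ℂ (Fin d)) :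
    Continuous fun Y : Fin d → Matrix (Fin n) (Fin n) ℂ => ncEval Y p := by
  induction p using FreeAlgebra.induction with
  | grade0 c => simpa only [AlgHom.commutes] using continuous_const
  | grade1 i => simpa [ncEval] using continuous_apply i
  | mul a b ha hb => simpa only [map_mul] using ha.matrix_mul hb
  | add a b ha hb => simp only [map_add]; exact ha.add hb

lemma continuous_ncEvalM {d k n : ℕ} (P : Matrix (Fin k) (Fin k) (FreeAlgebra ℂ (Fin d))) :
    Continuous fun Y : Fin d → Matrix (Fin n) (Fin n) ℂ => ncEvalM P Y :=
  continuous_matrix fun p q => (continuous_ncEval (P p.1 q.1)).matrix_elem p.2 q.2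

lemma QStable.isUnit {d k l : ℕ} {Q : Fin d → Matrix (Fin l) (Fin l) ℂ}
    {P : Matrix (Fin k) (Fin k) (FreeAlgebra ℂ (Fin d))} (h : QStable Q P) {n : ℕ}
    {Y : Fin d → Matrix (Fin n) (Fin n) ℂ} (hY : ‖∑ j, Q j ⊗ₖ Y j‖ < 1) :
    IsUnit (ncEvalM P Y) := by
  cases n with
  | zero => exact isUnit_of_subsingleton _
  | succ n => exact h n Y hY

lemma QStable.exists_bound_fixed_size {d k l : ℕ} {Q : Fin d → Matrix (Fin l) (Fin l) ℂ}
    {P : Matrix (Fin k) (Fin k) (FreeAlgebra ℂ (Fin d))} (h : QStable Q P)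
    (hQ : LinearIndependent ℂ Q) {r : ℝ} (hr : r < 1) (n : ℕ) :
    ∃ C : ℝ, ∀ Y : Fin d → Matrix (Fin n) (Fin n) ℂ, ‖∑ j, Q j ⊗ₖ Y j‖ ≤ r →
      ‖(ncEvalM P Y)⁻¹‖ ≤ C := by
  obtain ⟨C, hC⟩ := (isCompact_setOf_norm_sum_kronecker_le hQ n r).exists_bound_of_continuousOn
    (f := fun Y => (ncEvalM P Y)⁻¹) fun Y hY => by
      obtain ⟨u, hu⟩ := h.isUnit (lt_of_le_of_lt hY hr)
      have hc := NormedRing.inverse_continuousAt u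
      rw [hu] at hc
      simp only [Matrix.nonsing_inv_eq_ringInverse]
      exact (hc.comp (f := fun Y => ncEvalM P Y)
        (continuous_ncEvalM P).continuousAt).continuousWithinAt
  exact ⟨C, hC⟩

lemma QStable.exists_uniform_bound {d k l : ℕ} {Q : Fin d → Matrix (Fin l) (Fin l) ℂ}
    {P : Matrix (Fin k) (Fin k) (FreeAlgebra ℂ (Fin d))} (h : QStable Q P)
    (hQ : LinearIndependent ℂ Q) {r : ℝ} (hr : r < 1) :
    ∃ C : ℝ, ∀ (n : ℕ) (Y : Fin d → Matrix (Fin n) (Fin n) ℂ), ‖∑ j, Q j ⊗ₖ Y j‖ ≤ r →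
      ‖(ncEvalM P Y)⁻¹‖ ≤ C := by
  obtain ⟨D, hD⟩ := exists_forall_mem_affinePoly_pow P
  choose C hC using h.exists_bound_fixed_size hQ hr
  set N := Module.finrank ℂ (Fin k → (affinePoly d ^ D : Submodule ℂ (FreeAlgebra ℂ (Fin d))))
  refine ⟨∑ m ∈ Finset.range (N + 1), |C m|, fun n Y hY => ?_⟩
  have hunit := (Matrix.isUnit_iff_isUnit_det _).1 (h.isUnit (lt_of_le_of_lt hY hr))
  rw [Matrix.cstar_norm_def]
  refine ContinuousLinearMap.opNorm_le_bound _ (Finset.sum_nonneg fun _ _ => abs_nonneg _)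
    fun w => ?_
  set v := (ncEvalM P Y)⁻¹ *ᵥ w.ofLp with hv
  obtain ⟨m, hm, U, hU, hUv, hPv⟩ := exists_compress_ncEvalM_mulVec D P hD Y v
  set V := (1 : Matrix (Fin k) (Fin k) ℂ) ⊗ₖ U
  have hV : Vᴴ * V = 1 := one_kronecker_isometry k hU
  have hY' := (norm_sum_kronecker_compress_le Q hU Y).trans hY
  have hunit' := (Matrix.isUnit_iff_isUnit_det _).1 (h.isUnit (lt_of_le_of_lt hY' hr))
  have hw : w.ofLp = V *ᵥ (ncEvalM P (compress U Y) *ᵥ (Vᴴ *ᵥ v)) := by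
    rw [← hPv, hv, Matrix.mulVec_mulVec, Matrix.mul_nonsing_inv _ hunit, Matrix.one_mulVec]
  have hvw : (V * (ncEvalM P (compress U Y))⁻¹ * Vᴴ) *ᵥ w.ofLp = v := by
    rw [hw, Matrix.mulVec_mulVec, Matrix.mul_assoc, Matrix.mul_assoc, hV, Matrix.mul_one,
      ← Matrix.mulVec_mulVec, Matrix.mulVec_mulVec (Vᴴ *ᵥ v),
      Matrix.nonsing_inv_mul _ hunit', Matrix.one_mulVec, hUv]
  have hbound := Matrix.l2_opNorm_mulVec (V * (ncEvalM P (compress U Y))⁻¹ * Vᴴ) w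
  rw [hvw] at hbound
  refine le_trans hbound (mul_le_mul_of_nonneg_right ?_ (norm_nonneg _))
  calc _ ≤ ‖(ncEvalM P (compress U Y))⁻¹‖ := norm_isometry_conj_le hV _
    _ ≤ |C m| := (hC m _ hY').trans (le_abs_self _)
    _ ≤ _ := Finset.single_le_sum (f := fun m => |C m|) (fun _ _ => abs_nonneg _)
      (Finset.mem_range.2 (Nat.lt_succ_of_le hm))

lemma memBallQ.norm_dilate_le {d l n : ℕ} {Q : Fin d → Matrix (Fin l) (Fin l) ℂ}
    {X : Fin d → Matrix (Fin n) (Fin n) ℂ} (hX : memBallQ Q X) {r : ℝ} (hr : 0 ≤ r) :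
    ‖∑ j, Q j ⊗ₖ ((r : ℂ) • X j)‖ ≤ r := by
  have hX' : ‖∑ j, Q j ⊗ₖ X j‖ < 1 := hX
  simp only [Matrix.kronecker_smul, ← Finset.smul_sum]
  rw [norm_smul, Complex.norm_real, Real.norm_of_nonneg hr]
  exact mul_le_of_le_one_right hr hX'.le

end

/-- **Uniform boundedness of inverses of dilated stable polynomials.**
If `P ∈ M_k(ℂ⟨Z⟩)` is `Q`-stable, then for each fixed `r ∈ [0,1)` there is a
finite `C_r` such that `P(rX)` is invertible and `‖P(rX)⁻¹‖ ≤ C_r` for every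
`n ≥ 1` and `X ∈ 𝔻_Q(n)`. -/
theorem dilated_inverse_uniformly_bounded {d k l : ℕ} (hd : 0 < d) (hk : 0 < k)
    (hl : 0 < l)
    (Q : Fin d → Matrix (Fin l) (Fin l) ℂ) (hQ : LinearIndependent ℂ Q)
    (P : Matrix (Fin k) (Fin k) (FreeAlgebra ℂ (Fin d)))
    (hstable : QStable Q P) :
    ∀ (r : ℝ), 0 ≤ r → r < 1 → ∃ C : ℝ,
      ∀ (n : ℕ) (X : Fin d → Matrix (Fin (n + 1)) (Fin (n + 1)) ℂ), memBallQ Q X →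
        IsUnit (ncEvalM P (fun i => (r : ℂ) • X i)) ∧
        opNorm ((ncEvalM P (fun i => (r : ℂ) • X i))⁻¹) ≤ C := by
  intro r hr hr1
  obtain ⟨C, hC⟩ := hstable.exists_uniform_bound hQ hr1
  exact ⟨C, fun n X hX => ⟨hstable.isUnit (lt_of_le_of_lt (hX.norm_dilate_le hr) hr1),
    hC _ _ (hX.norm_dilate_le hr)⟩⟩
end
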